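/- arXiv:1912.00014 — 3 statements merged into one kernel-verified Lean document; each statement's English description precedes it below -/
import Mathlib

section
/- (Bonnet-type theorem, first type) Let K, ϰ : D → ℝ be smooth functions on an open set D ⊆ ℝ² with K² − ϰ² > 0 on D, satisfying the system of natural equations |K² − ϰ²|^{1/4}·Δ^h(ln|K² − ϰ²|) = −8K and |K² − ϰ²|^{1/4}·Δ^h(ln|(K + ϰ)/(K − ϰ)|) = −4ϰ. Then for every t₀ ∈ D there exist an open neighborhood D₀ ⊆ D of t₀ and a smooth minimal time-like surface x : D₀ → ℝ⁴ in canonical coordinates with parameters (ε₀,ε₁) = (1,0) whose Gauss curvature and normal curvature coincide with the given K and ϰ on D₀. Moreover, if x̂ is another such surface defined on a neighborhood of t₀, then there exist a neighborhood D̃₀ of t₀, a linear map A : ℝ⁴ → ℝ⁴ with ⟨Av,Aw⟩ = ⟨v,w⟩ for all v,w and det A = 1, and c ∈ ℝ⁴, such that x̂ = A∘x + c on D̃₀. -/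
noncomputable section

abbrev V4 : Type := Fin 4 → ℝ

/-- The indefinite scalar product of `ℝ⁴₂`. -/
def ip (a b : V4) : ℝ := -(a 0 * b 0) + a 1 * b 1 - a 2 * b 2 + a 3 * b 3

/-- Partial derivative w.r.t. the first variable. -/
def pu {E : Type*} [NormedAddCommGroup E] [NormedSpace ℝ E]
    (f : ℝ × ℝ → E) (p : ℝ × ℝ) : E := fderiv ℝ f p (1, 0)

/-- Partial derivative w.r.t. the second variable. -/
def pv {E : Type*} [NormedAddCommGroup E] [NormedSpace ℝ E]
    (f : ℝ × ℝ → E) (p : ℝ × ℝ) : E := fderiv ℝ f p (0, 1)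

/-- `E`, the first coefficient of the first fundamental form. -/
def Ef (x : ℝ × ℝ → V4) (p : ℝ × ℝ) : ℝ := ip (pu x p) (pu x p)

/-- Normal projection of a vector `w` at the point `p` of the surface `x`:
`w^⊥ = w − (⟨w,x_u⟩/E)·x_u + (⟨w,x_v⟩/E)·x_v`. -/
def nproj (x : ℝ × ℝ → V4) (w : V4) (p : ℝ × ℝ) : V4 :=
  w - (ip w (pu x p) / Ef x p) • pu x p + (ip w (pv x p) / Ef x p) • pv x p

/-- `a = (x_uu)^⊥`. -/
def sffA (x : ℝ × ℝ → V4) (p : ℝ × ℝ) : V4 := nproj x (pu (pu x) p) p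

/-- `b = (x_uv)^⊥`. -/
def sffB (x : ℝ × ℝ → V4) (p : ℝ × ℝ) : V4 := nproj x (pv (pu x) p) p

/-- Determinant of the 4×4 matrix with columns `v1, v2, v3, v4`. -/
def det4 (v1 v2 v3 v4 : V4) : ℝ := (Matrix.of ![v1, v2, v3, v4]).transpose.det

/-- The Gauss curvature `K = (⟨b,b⟩ − ⟨a,a⟩)/E²`. -/
def GaussK (x : ℝ × ℝ → V4) (p : ℝ × ℝ) : ℝ :=
  (ip (sffB x p) (sffB x p) - ip (sffA x p) (sffA x p)) / (Ef x p) ^ 2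

/-- The curvature of the normal connection `ϰ = −2·det[x_u,x_v,a,b]/E³`. -/
def NormK (x : ℝ × ℝ → V4) (p : ℝ × ℝ) : ℝ :=
  -2 * det4 (pu x p) (pv x p) (sffA x p) (sffB x p) / (Ef x p) ^ 3

/-- The hyperbolic Laplacian `Δʰ f = f_uu − f_vv`. -/
def hlap (f : ℝ × ℝ → ℝ) (p : ℝ × ℝ) : ℝ := pu (pu f) p - pv (pv f) p

/-- Time-like surface in isothermal coordinates with `E < 0`. -/
def IsTimelikeIso (D : Set (ℝ × ℝ)) (x : ℝ × ℝ → V4) : Prop :=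
  ∀ p ∈ D, Ef x p < 0 ∧ ip (pv x p) (pv x p) = -(Ef x p) ∧ ip (pu x p) (pv x p) = 0

/-- Minimality: `x_uu − x_vv = 0`. -/
def IsMinimal (D : Set (ℝ × ℝ)) (x : ℝ × ℝ → V4) : Prop :=
  ∀ p ∈ D, pu (pu x) p - pv (pv x) p = 0

/-- Degenerate point: `(⟨a,a⟩+⟨b,b⟩)² = 4⟨a,b⟩²`. -/
def DegeneratePt (x : ℝ × ℝ → V4) (p : ℝ × ℝ) : Prop :=
  (ip (sffA x p) (sffA x p) + ip (sffB x p) (sffB x p)) ^ 2 =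
    4 * (ip (sffA x p) (sffB x p)) ^ 2

/-- Surface of the first type. -/
def FirstType (D : Set (ℝ × ℝ)) (x : ℝ × ℝ → V4) : Prop :=
  ∀ p ∈ D,
    (ip (sffA x p) (sffA x p) + ip (sffB x p) (sffB x p)) ^ 2 -
      4 * (ip (sffA x p) (sffB x p)) ^ 2 > 0 ∧
    ip (sffA x p) (sffA x p) + ip (sffB x p) (sffB x p) > 0

/-- Surface of the second type. -/
def SecondType (D : Set (ℝ × ℝ)) (x : ℝ × ℝ → V4) : Prop :=
  ∀ p ∈ D,
    (ip (sffA x p) (sffA x p) + ip (sffB x p) (sffB x p)) ^ 2 -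
      4 * (ip (sffA x p) (sffB x p)) ^ 2 > 0 ∧
    ip (sffA x p) (sffA x p) + ip (sffB x p) (sffB x p) < 0

/-- Surface of the third type. -/
def ThirdType (D : Set (ℝ × ℝ)) (x : ℝ × ℝ → V4) : Prop :=
  ∀ p ∈ D,
    (ip (sffA x p) (sffA x p) + ip (sffB x p) (sffB x p)) ^ 2 -
      4 * (ip (sffA x p) (sffB x p)) ^ 2 < 0

/-- Canonical coordinates with parameters `(e0, e1)`:
`⟨a,a⟩+⟨b,b⟩ = e0` and `2⟨a,b⟩ = e1` identically. -/
def Canonical (D : Set (ℝ × ℝ)) (x : ℝ × ℝ → V4) (e0 e1 : ℝ) : Prop :=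
  ∀ p ∈ D,
    ip (sffA x p) (sffA x p) + ip (sffB x p) (sffB x p) = e0 ∧
    2 * ip (sffA x p) (sffB x p) = e1

/-- A minimal time-like surface in canonical coordinates with parameters (1, 0). -/
def GoodSurf (D₀ : Set (ℝ × ℝ)) (x : ℝ × ℝ → V4) : Prop :=
  ContDiffOn ℝ (⊤ : ℕ∞) x D₀ ∧ IsTimelikeIso D₀ x ∧ IsMinimal D₀ x ∧
    Canonical D₀ x (1) (0)


open scoped ContDiff Topology

/-- The directional derivative of `f` along `e`. -/
def dd {E : Type*} [NormedAddCommGroup E] [NormedSpace ℝ E]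
    (e : ℝ × ℝ) (f : ℝ × ℝ → E) (p : ℝ × ℝ) : E := fderiv ℝ f p e

section DirectionalDerivative

variable {E : Type*} [NormedAddCommGroup E] [NormedSpace ℝ E]

lemma dd_congr {U : Set (ℝ × ℝ)} (hU : IsOpen U) {f g : ℝ × ℝ → E} (h : ∀ p ∈ U, f p = g p)
    (e : ℝ × ℝ) {p : ℝ × ℝ} (hp : p ∈ U) : dd e f p = dd e g p := by
  have : f =ᶠ[𝓝 p] g := Filter.eventually_of_mem (hU.mem_nhds hp) h
  rw [dd, dd, this.fderiv_eq]

lemma dd_const (e : ℝ × ℝ) (c : E) (p : ℝ × ℝ) : dd e (fun _ => c) p = 0 := by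
  simp [dd]

lemma contDiffAt_dd {f : ℝ × ℝ → E} {p : ℝ × ℝ} (hf : ContDiffAt ℝ ∞ f p) (e : ℝ × ℝ) :
    ContDiffAt ℝ ∞ (dd e f) p := by
  have := hf.fderiv_right (m := ∞) (by simp)
  exact this.clm_apply contDiffAt_const

lemma smooth_differentiableAt {F : Type*} [NormedAddCommGroup F] [NormedSpace ℝ F]
    {f : F → E} {p : F} (hf : ContDiffAt ℝ ∞ f p) :
    DifferentiableAt ℝ f p := hf.differentiableAt (by simp)

lemma dd_comm {f : ℝ × ℝ → E} {p : ℝ × ℝ} (hf : ContDiffAt ℝ ∞ f p) (e e' : ℝ × ℝ) :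
    dd e (dd e' f) p = dd e' (dd e f) p := by
  have hs : IsSymmSndFDerivAt ℝ f p :=
    hf.isSymmSndFDerivAt (by simpa using WithTop.coe_le_coe.2 (le_top : (2 : ℕ∞) ≤ ⊤))
  have hd : DifferentiableAt ℝ (fderiv ℝ f) p :=
    smooth_differentiableAt (hf.fderiv_right (m := ∞) (by simp))
  have h (e e' : ℝ × ℝ) : dd e (dd e' f) p = fderiv ℝ (fderiv ℝ f) p e e' := by
    have : HasFDerivAt (dd e' f) ((fderiv ℝ (fderiv ℝ f) p).flip e') p := by
      simpa using! hd.hasFDerivAt.clm_apply (hasFDerivAt_const e' p)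
    rw [dd, this.fderiv]; rfl
  rw [h, h, hs.eq]

lemma dd_add_dir (e e' : ℝ × ℝ) (f : ℝ × ℝ → E) (p : ℝ × ℝ) :
    dd (e + e') f p = dd e f p + dd e' f p := by simp [dd]

lemma dd_sub_dir (e e' : ℝ × ℝ) (f : ℝ × ℝ → E) (p : ℝ × ℝ) :
    dd (e - e') f p = dd e f p - dd e' f p := by simp [dd]

lemma dd_add (e : ℝ × ℝ) {f g : ℝ × ℝ → E} {p : ℝ × ℝ} (hf : DifferentiableAt ℝ f p)
    (hg : DifferentiableAt ℝ g p) : dd e (fun q => f q + g q) p = dd e f p + dd e g p := by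
  simp [dd, fderiv_fun_add hf hg]

lemma dd_sub (e : ℝ × ℝ) {f g : ℝ × ℝ → E} {p : ℝ × ℝ} (hf : DifferentiableAt ℝ f p)
    (hg : DifferentiableAt ℝ g p) : dd e (fun q => f q - g q) p = dd e f p - dd e g p := by
  simp [dd, fderiv_fun_sub hf hg]

lemma dd_smul (e : ℝ × ℝ) {c : ℝ × ℝ → ℝ} {f : ℝ × ℝ → E} {p : ℝ × ℝ}
    (hc : DifferentiableAt ℝ c p) (hf : DifferentiableAt ℝ f p) :
    dd e (fun q => c q • f q) p = c p • dd e f p + dd e c p • f p := by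
  simp [dd, fderiv_fun_smul hc hf]

lemma dd_mul (e : ℝ × ℝ) {f g : ℝ × ℝ → ℝ} {p : ℝ × ℝ} (hf : DifferentiableAt ℝ f p)
    (hg : DifferentiableAt ℝ g p) :
    dd e (fun q => f q * g q) p = f p * dd e g p + dd e f p * g p := by
  simp [dd, fderiv_fun_mul hf hg]; ring

lemma dd_inv (e : ℝ × ℝ) {f : ℝ × ℝ → ℝ} {p : ℝ × ℝ} (hf : DifferentiableAt ℝ f p)
    (h0 : f p ≠ 0) : dd e (fun q => (f q)⁻¹) p = -(dd e f p / (f p) ^ 2) := by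
  have := (hasDerivAt_inv h0).comp_hasFDerivAt p hf.hasFDerivAt
  rw [dd, HasFDerivAt.fderiv (f := fun q => (f q)⁻¹) this]
  simp [dd]; ring

lemma dd_apply (e : ℝ × ℝ) {f : ℝ × ℝ → V4} {p : ℝ × ℝ} (hf : DifferentiableAt ℝ f p)
    (i : Fin 4) : dd e (fun q => f q i) p = dd e f p i := by
  have := hasFDerivAt_pi'.1 hf.hasFDerivAt i
  rw [dd, this.fderiv]; rfl

lemma differentiableAt_coord {f : ℝ × ℝ → V4} {p : ℝ × ℝ} (hf : DifferentiableAt ℝ f p)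
    (i : Fin 4) : DifferentiableAt ℝ (fun q => f q i) p := differentiableAt_pi.1 hf i

lemma dd_ip (e : ℝ × ℝ) {f g : ℝ × ℝ → V4} {p : ℝ × ℝ} (hf : DifferentiableAt ℝ f p)
    (hg : DifferentiableAt ℝ g p) :
    dd e (fun q => ip (f q) (g q)) p = ip (dd e f p) (g p) + ip (f p) (dd e g p) := by
  have F := fun i => (differentiableAt_coord hf i).hasFDerivAt
  have G := fun i => (differentiableAt_coord hg i).hasFDerivAt
  have H := ((((F 0).mul (G 0)).neg.add ((F 1).mul (G 1))).sub ((F 2).mul (G 2))).add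
    ((F 3).mul (G 3))
  have : dd e (fun q => ip (f q) (g q)) p = _ := congrArg (fun L => L e) H.fderiv
  rw [this]
  simp only [ip, ← dd_apply e hf, ← dd_apply e hg]
  simp [dd]
  ring

lemma contDiffAt_ip {f g : ℝ × ℝ → V4} {p : ℝ × ℝ} (hf : ContDiffAt ℝ ∞ f p)
    (hg : ContDiffAt ℝ ∞ g p) : ContDiffAt ℝ ∞ (fun q => ip (f q) (g q)) p := by
  have F := contDiffAt_pi.1 hf
  have G := contDiffAt_pi.1 hg
  exact ((((F 0).mul (G 0)).neg.add ((F 1).mul (G 1))).sub ((F 2).mul (G 2))).add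
    ((F 3).mul (G 3))

end DirectionalDerivative

section LinearAlgebra

lemma ip_comm (a b : V4) : ip a b = ip b a := by simp only [ip]; ring

lemma ip_add_left (a b c : V4) : ip (a + b) c = ip a c + ip b c := by
  simp only [ip, Pi.add_apply]; ring

lemma ip_sub_left (a b c : V4) : ip (a - b) c = ip a c - ip b c := by
  simp only [ip, Pi.sub_apply]; ring

lemma ip_smul_left (r : ℝ) (a b : V4) : ip (r • a) b = r * ip a b := by
  simp only [ip, Pi.smul_apply, smul_eq_mul]; ring

lemma ip_add_right (a b c : V4) : ip a (b + c) = ip a b + ip a c := by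
  simp only [ip, Pi.add_apply]; ring

lemma ip_sub_right (a b c : V4) : ip a (b - c) = ip a b - ip a c := by
  simp only [ip, Pi.sub_apply]; ring

lemma ip_smul_right (r : ℝ) (a b : V4) : ip a (r • b) = r * ip a b := by
  simp only [ip, Pi.smul_apply, smul_eq_mul]; ring

/-- The determinant of the columns `a, b, c` restricted to the coordinates `i, j, k`. -/
def minor (a b c : V4) (i j k : Fin 4) : ℝ :=
  a i * (b j * c k - b k * c j) - a j * (b i * c k - b k * c i) + a k * (b i * c j - b j * c i)

lemma det4_eq (a b c d : V4) : det4 a b c d =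
    -(minor a b c 1 2 3) * d 0 + minor a b c 0 2 3 * d 1 - minor a b c 0 1 3 * d 2
      + minor a b c 0 1 2 * d 3 := by
  simp [det4, Matrix.det_transpose, Matrix.det_succ_row_zero, Fin.sum_univ_succ, minor,
    Fin.succAbove]
  ring

/-- The triple cross product of `ℝ⁴₂`. -/
def cross (a b c : V4) : V4 :=
  ![minor a b c 1 2 3, minor a b c 0 2 3, minor a b c 0 1 3, minor a b c 0 1 2]

lemma ip_cross (a b c d : V4) : ip (cross a b c) d = det4 a b c d := by
  rw [det4_eq]; simp [ip, cross]

lemma det4_comb (a b a' b' : V4) (r s r' s' : ℝ) :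
    det4 (a + b) (a - b) ((r • a' - s • a) + (r' • b' - s' • b))
      ((r • a' - s • a) - (r' • b' - s' • b)) = 4 * r * r' * det4 a b a' b' := by
  simp only [det4_eq, minor, Pi.add_apply, Pi.sub_apply, Pi.smul_apply, smul_eq_mul]
  ring

lemma ip_cross_left (a b c : V4) : ip (cross a b c) a = 0 := by
  rw [ip_cross, det4_eq]; simp only [minor]; ring

lemma ip_cross_middle (a b c : V4) : ip (cross a b c) b = 0 := by
  rw [ip_cross, det4_eq]; simp only [minor]; ring

lemma ip_cross_right (a b c : V4) : ip (cross a b c) c = 0 := by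
  rw [ip_cross, det4_eq]; simp only [minor]; ring

lemma ip_cross_self (a b c : V4) : ip (cross a b c) (cross a b c) =
    ip a a * (ip b b * ip c c - ip b c ^ 2) - ip a b * (ip a b * ip c c - ip b c * ip a c)
      + ip a c * (ip a b * ip b c - ip b b * ip a c) := by
  rw [ip_cross, det4_eq]
  simp [minor, cross, ip]
  ring

/-- `(α, β, n, m)` is a positively oriented frame consisting of two null vectors `α, β` with
`⟨α, β⟩ = P` and of an orthonormal basis `n, m` of the orthogonal complement of their span. -/
structure IsFrame (P : ℝ) (α β n m : V4) : Prop where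
  ne : P ≠ 0
  aa : ip α α = 0
  bb : ip β β = 0
  ab : ip α β = P
  na : ip n α = 0
  nb : ip n β = 0
  nn : ip n n = 1
  ma : ip m α = 0
  mb : ip m β = 0
  mn : ip m n = 0
  mm : ip m m = -1
  det : det4 α β n m = -P

lemma isFrame_cross {P : ℝ} {α β n : V4} (ne : P ≠ 0) (aa : ip α α = 0) (bb : ip β β = 0)
    (ab : ip α β = P) (na : ip n α = 0) (nb : ip n β = 0) (nn : ip n n = 1) :
    IsFrame P α β n (P⁻¹ • cross α β n) := by
  have h : ip (cross α β n) (cross α β n) = -P ^ 2 := by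
    rw [ip_cross_self, aa, bb, ab, ip_comm α n, ip_comm β n, na, nb, nn]; ring
  refine ⟨ne, aa, bb, ab, na, nb, nn, ?_, ?_, ?_, ?_, ?_⟩
  · rw [ip_smul_left, ip_cross_left, mul_zero]
  · rw [ip_smul_left, ip_cross_middle, mul_zero]
  · rw [ip_smul_left, ip_cross_right, mul_zero]
  · rw [ip_smul_left, ip_smul_right, h]; field_simp
  · rw [← ip_cross, ip_smul_right, h]; field_simp

namespace IsFrame

/-- The linear map taking the frame `(α, β, n, m)` to `(α', β', n', m')`. -/
def map (P : ℝ) (α β n m α' β' n' m' v : V4) : V4 :=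
  (P⁻¹ * ip v β) • α' + (P⁻¹ * ip v α) • β' + ip v n • n' - ip v m • m'

/-- The matrix whose columns are the vectors of a frame. -/
def cols (α β n m : V4) : Matrix (Fin 4) (Fin 4) ℝ := (Matrix.of ![α, β, n, m]).transpose

/-- The matrix whose rows are the linear forms dual to a frame. -/
def dualRows (P : ℝ) (α β n m : V4) : Matrix (Fin 4) (Fin 4) ℝ :=
  Matrix.of ![![-(P⁻¹ * β 0), P⁻¹ * β 1, -(P⁻¹ * β 2), P⁻¹ * β 3],
    ![-(P⁻¹ * α 0), P⁻¹ * α 1, -(P⁻¹ * α 2), P⁻¹ * α 3],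
    ![-n 0, n 1, -n 2, n 3], ![m 0, -m 1, m 2, -m 3]]

lemma cols_mul_dualRows_mulVec (P : ℝ) (α β n m α' β' n' m' v : V4) :
    (cols α' β' n' m' * dualRows P α β n m).mulVec v = map P α β n m α' β' n' m' v := by
  rw [← Matrix.mulVec_mulVec]
  ext i
  simp [Matrix.mulVec, dotProduct, cols, dualRows, map, Fin.sum_univ_four, ip]
  ring

variable {P : ℝ} {α β n m α' β' n' m' : V4}

lemma dualRows_mul_cols (h : IsFrame P α β n m) : dualRows P α β n m * cols α β n m = 1 := by
  have ne := h.ne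
  obtain ⟨-, aa, bb, ab, na, nb, nn, ma, mb, mn, mm, -⟩ := h
  simp only [ip] at aa bb ab na nb nn ma mb mn mm
  ext i j
  fin_cases i <;> fin_cases j <;>
    simp [Matrix.mul_apply, cols, dualRows, Fin.sum_univ_four] <;> field_simp <;> linarith

lemma map_self (h : IsFrame P α β n m) (v : V4) : map P α β n m α β n m v = v := by
  rw [← cols_mul_dualRows_mulVec, mul_eq_one_comm.1 h.dualRows_mul_cols, Matrix.one_mulVec]

lemma ext_ip (h : IsFrame P α β n m) {v w : V4} (h1 : ip v α = ip w α) (h2 : ip v β = ip w β)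
    (h3 : ip v n = ip w n) (h4 : ip v m = ip w m) : v = w := by
  rw [← h.map_self v, ← h.map_self w, map, map, h1, h2, h3, h4]

lemma ip_map (h : IsFrame P α β n m) (h' : IsFrame P α' β' n' m') (v w : V4) :
    ip (map P α β n m α' β' n' m' v) (map P α β n m α' β' n' m' w) = ip v w := by
  have key {α' β' n' m' : V4} (h' : IsFrame P α' β' n' m') :
      ip (map P α β n m α' β' n' m' v) (map P α β n m α' β' n' m' w) =
      P⁻¹ * (ip v β * ip w α + ip v α * ip w β) + ip v n * ip w n - ip v m * ip w m := by
    have ne := h'.ne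
    simp only [map, ip_add_left, ip_add_right, ip_sub_left, ip_sub_right, ip_smul_left,
      ip_smul_right, h'.aa, h'.bb, h'.ab, h'.na, h'.nb, h'.nn, h'.ma, h'.mb, h'.mn, h'.mm,
      ip_comm β' α', ip_comm α' n', ip_comm β' n', ip_comm α' m', ip_comm β' m', ip_comm n' m']
    field_simp
    ring
  rw [key h', ← key h, h.map_self, h.map_self]

lemma map_left (h : IsFrame P α β n m) : map P α β n m α' β' n' m' α = α' := by
  simp [map, h.aa, h.ab, ip_comm α n, ip_comm α m, h.na, h.ma, h.ne]

lemma map_right (h : IsFrame P α β n m) : map P α β n m α' β' n' m' β = β' := by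
  simp [map, h.bb, ip_comm β α, h.ab, ip_comm β n, ip_comm β m, h.nb, h.mb, h.ne]

lemma exists_linearMap (h : IsFrame P α β n m) (h' : IsFrame P α' β' n' m') :
    ∃ A : V4 →ₗ[ℝ] V4, (∀ v, A v = map P α β n m α' β' n' m' v) ∧ LinearMap.det A = 1 := by
  refine ⟨Matrix.toLin' (cols α' β' n' m' * dualRows P α β n m), fun v => ?_, ?_⟩
  · rw [Matrix.toLin'_apply, cols_mul_dualRows_mulVec]
  · have h1 : (cols α β n m).det = -P := h.det
    have h2 : (cols α' β' n' m').det = -P := h'.det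
    have h3 := congrArg Matrix.det h.dualRows_mul_cols
    rw [Matrix.det_mul, h1, Matrix.det_one] at h3
    rw [LinearMap.det_toLin', Matrix.det_mul, h2, ← h3]; ring

end IsFrame

end LinearAlgebra

section NullCoordinates

/-- The first null direction of the parameter plane. -/
def es : ℝ × ℝ := (1 / 2, 1 / 2)

/-- The second null direction of the parameter plane. -/
def et : ℝ × ℝ := (1 / 2, -1 / 2)

variable {E : Type*} [NormedAddCommGroup E] [NormedSpace ℝ E]

lemma pu_eq (f : ℝ × ℝ → E) (p : ℝ × ℝ) : pu f p = dd es f p + dd et f p := by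
  rw [← dd_add_dir]; norm_num [pu, dd, es, et]

lemma pv_eq (f : ℝ × ℝ → E) (p : ℝ × ℝ) : pv f p = dd es f p - dd et f p := by
  rw [← dd_sub_dir]; norm_num [pv, dd, es, et]

lemma pu_pu_eq {f : ℝ × ℝ → E} {p : ℝ × ℝ} (hf : ContDiffAt ℝ ∞ f p) :
    pu (pu f) p = dd es (dd es f) p + dd et (dd et f) p + (2 : ℝ) • dd et (dd es f) p := by
  have h : pu f = fun q => dd es f q + dd et f q := funext (pu_eq f)
  have hs := smooth_differentiableAt (contDiffAt_dd hf es)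
  have ht := smooth_differentiableAt (contDiffAt_dd hf et)
  rw [pu_eq, h, dd_add _ hs ht, dd_add _ hs ht, dd_comm hf es et]
  module

lemma pv_pu_eq {f : ℝ × ℝ → E} {p : ℝ × ℝ} (hf : ContDiffAt ℝ ∞ f p) :
    pv (pu f) p = dd es (dd es f) p - dd et (dd et f) p := by
  have h : pu f = fun q => dd es f q + dd et f q := funext (pu_eq f)
  have hs := smooth_differentiableAt (contDiffAt_dd hf es)
  have ht := smooth_differentiableAt (contDiffAt_dd hf et)
  rw [pv_eq, h, dd_add _ hs ht, dd_add _ hs ht, dd_comm hf es et]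
  module

lemma pv_pv_eq {f : ℝ × ℝ → E} {p : ℝ × ℝ} (hf : ContDiffAt ℝ ∞ f p) :
    pv (pv f) p = dd es (dd es f) p + dd et (dd et f) p - (2 : ℝ) • dd et (dd es f) p := by
  have h : pv f = fun q => dd es f q - dd et f q := funext (pv_eq f)
  have hs := smooth_differentiableAt (contDiffAt_dd hf es)
  have ht := smooth_differentiableAt (contDiffAt_dd hf et)
  rw [pv_eq, h, dd_sub _ hs ht, dd_sub _ hs ht, dd_comm hf es et]
  module

lemma pu_pu_sub_pv_pv {f : ℝ × ℝ → E} {p : ℝ × ℝ} (hf : ContDiffAt ℝ ∞ f p) :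
    pu (pu f) p - pv (pv f) p = (4 : ℝ) • dd et (dd es f) p := by
  rw [pu_pu_eq hf, pv_pv_eq hf]; module

end NullCoordinates

section Curvatures

/-- Twice the component of `w` normal to the plane spanned by the null vectors `α` and `β`, for
`w` orthogonal to `α`. -/
def nullNormal (α β w : V4) : V4 := (2 : ℝ) • w - (2 * (ip w β / ip α β)) • α

lemma ip_nullNormal_nullNormal {α β a b : V4} (hP : ip α β ≠ 0) :
    ip (nullNormal α β a) (nullNormal β α b) =
      4 * (ip a b - ip a β * ip α b / ip α β) := by
  simp only [nullNormal, ip_sub_left, ip_sub_right, ip_smul_left, ip_smul_right, ip_comm β α,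
    ip_comm b α]
  field_simp
  ring

lemma ip_nullNormal_self {α β a : V4} (aa : ip α α = 0) (ha : ip a α = 0) :
    ip (nullNormal α β a) (nullNormal α β a) = 4 * ip a a := by
  simp only [nullNormal, ip_sub_left, ip_sub_right, ip_smul_left, ip_smul_right, aa, ha,
    ip_comm α a]
  ring

lemma ip_nullNormal_left {α β a : V4} (aa : ip α α = 0) (ha : ip a α = 0) :
    ip (nullNormal α β a) α = 0 := by
  simp only [nullNormal, ip_sub_left, ip_smul_left, aa, ha]
  ring

lemma ip_nullNormal_right {α β : V4} (a : V4) (hP : ip α β ≠ 0) :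
    ip (nullNormal α β a) β = 0 := by
  simp only [nullNormal, ip_sub_left, ip_smul_left]
  field_simp
  ring

lemma det4_nullNormal (α β a b : V4) :
    det4 α β (nullNormal α β a) (nullNormal β α b) = 4 * det4 α β a b := by
  simp only [nullNormal, det4_eq, minor, Pi.sub_apply, Pi.smul_apply, smul_eq_mul]
  ring

lemma half_nullNormal (α β w : V4) :
    (1 / 2 : ℝ) • nullNormal α β w = (1 : ℝ) • w - (ip w β / ip α β) • α := by
  rw [nullNormal]; module

variable {x : ℝ × ℝ → V4} {p : ℝ × ℝ}

lemma Ef_eq (aa : ip (dd es x p) (dd es x p) = 0) (bb : ip (dd et x p) (dd et x p) = 0) :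
    Ef x p = 2 * ip (dd es x p) (dd et x p) := by
  simp only [Ef, pu_eq, ip_add_left, ip_add_right, aa, bb, ip_comm (dd et x p) (dd es x p)]
  ring

lemma nproj_eq (aa : ip (dd es x p) (dd es x p) = 0) (bb : ip (dd et x p) (dd et x p) = 0)
    (w : V4) : nproj x w p = w - (ip w (dd et x p) / ip (dd es x p) (dd et x p)) • dd es x p
      - (ip w (dd es x p) / ip (dd es x p) (dd et x p)) • dd et x p := by
  rw [nproj, Ef_eq aa bb, pu_eq, pv_eq, ip_add_right, ip_sub_right]
  module

lemma sffA_eq (hx : ContDiffAt ℝ ∞ x p) (hmin : dd et (dd es x) p = 0)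
    (aa : ip (dd es x p) (dd es x p) = 0) (bb : ip (dd et x p) (dd et x p) = 0)
    (ha : ip (dd es (dd es x) p) (dd es x p) = 0) (hb : ip (dd et (dd et x) p) (dd et x p) = 0) :
    sffA x p = (1 / 2 : ℝ) • nullNormal (dd es x p) (dd et x p) (dd es (dd es x) p) +
      (1 / 2 : ℝ) • nullNormal (dd et x p) (dd es x p) (dd et (dd et x) p) := by
  rw [sffA, nproj_eq aa bb, pu_pu_eq hx, hmin, half_nullNormal, half_nullNormal,
    ip_comm (dd et x p) (dd es x p)]
  simp only [smul_zero, add_zero, ip_add_left, ha, hb]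
  module

lemma sffB_eq (hx : ContDiffAt ℝ ∞ x p)
    (aa : ip (dd es x p) (dd es x p) = 0) (bb : ip (dd et x p) (dd et x p) = 0)
    (ha : ip (dd es (dd es x) p) (dd es x p) = 0) (hb : ip (dd et (dd et x) p) (dd et x p) = 0) :
    sffB x p = (1 / 2 : ℝ) • nullNormal (dd es x p) (dd et x p) (dd es (dd es x) p) -
      (1 / 2 : ℝ) • nullNormal (dd et x p) (dd es x p) (dd et (dd et x) p) := by
  rw [sffB, nproj_eq aa bb, pv_pu_eq hx, half_nullNormal, half_nullNormal,
    ip_comm (dd et x p) (dd es x p)]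
  simp only [ip_sub_left, ha, hb]
  module

lemma canonical_iff (hx : ContDiffAt ℝ ∞ x p) (hmin : dd et (dd es x) p = 0)
    (aa : ip (dd es x p) (dd es x p) = 0) (bb : ip (dd et x p) (dd et x p) = 0)
    (ha : ip (dd es (dd es x) p) (dd es x p) = 0) (hb : ip (dd et (dd et x) p) (dd et x p) = 0) :
    (ip (sffA x p) (sffA x p) + ip (sffB x p) (sffB x p) = 1 ∧
      2 * ip (sffA x p) (sffB x p) = 0) ↔
    ip (dd es (dd es x) p) (dd es (dd es x) p) = 1 / 4 ∧
      ip (dd et (dd et x) p) (dd et (dd et x) p) = 1 / 4 := by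
  have h1 := ip_nullNormal_self (β := dd et x p) aa ha
  have h2 := ip_nullNormal_self (β := dd es x p) bb hb
  rw [sffA_eq hx hmin aa bb ha hb, sffB_eq hx aa bb ha hb]
  simp only [ip_add_left, ip_add_right, ip_sub_left, ip_sub_right, ip_smul_left, ip_smul_right,
    h1, h2, ip_comm (nullNormal (dd et x p) _ _) (nullNormal (dd es x p) _ _)]
  constructor
  · rintro ⟨h, h'⟩
    constructor <;> linarith
  · rintro ⟨h, h'⟩
    constructor <;> linarith

lemma GaussK_eq (hx : ContDiffAt ℝ ∞ x p) (hmin : dd et (dd es x) p = 0)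
    (aa : ip (dd es x p) (dd es x p) = 0) (bb : ip (dd et x p) (dd et x p) = 0)
    (ha : ip (dd es (dd es x) p) (dd es x p) = 0) (hb : ip (dd et (dd et x) p) (dd et x p) = 0) :
    GaussK x p = -ip (nullNormal (dd es x p) (dd et x p) (dd es (dd es x) p))
      (nullNormal (dd et x p) (dd es x p) (dd et (dd et x) p)) / Ef x p ^ 2 := by
  rw [GaussK, sffA_eq hx hmin aa bb ha hb, sffB_eq hx aa bb ha hb]
  simp only [ip_add_left, ip_add_right, ip_sub_left, ip_sub_right, ip_smul_left, ip_smul_right,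
    ip_comm (nullNormal (dd et x p) _ _) (nullNormal (dd es x p) _ _)]
  ring

lemma NormK_eq (hx : ContDiffAt ℝ ∞ x p) (hmin : dd et (dd es x) p = 0)
    (aa : ip (dd es x p) (dd es x p) = 0) (bb : ip (dd et x p) (dd et x p) = 0)
    (ha : ip (dd es (dd es x) p) (dd es x p) = 0) (hb : ip (dd et (dd et x) p) (dd et x p) = 0) :
    NormK x p = -2 * det4 (dd es x p) (dd et x p)
      (nullNormal (dd es x p) (dd et x p) (dd es (dd es x) p))
      (nullNormal (dd et x p) (dd es x p) (dd et (dd et x) p)) / Ef x p ^ 3 := by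
  rw [NormK, sffA_eq hx hmin aa bb ha hb, sffB_eq hx aa bb ha hb, half_nullNormal, half_nullNormal,
    pu_eq, pv_eq, det4_comb, det4_nullNormal]
  ring

end Curvatures

section Rigidity

lemma dd_ip_const (e : ℝ × ℝ) {U : Set (ℝ × ℝ)} (hU : IsOpen U) {f g : ℝ × ℝ → V4}
    {c : ℝ} (h : ∀ p ∈ U, ip (f p) (g p) = c) {p : ℝ × ℝ} (hp : p ∈ U)
    (hf : DifferentiableAt ℝ f p) (hg : DifferentiableAt ℝ g p) :
    ip (dd e f p) (g p) = -ip (f p) (dd e g p) := by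
  have h1 := dd_congr hU h e hp
  rw [dd_ip e hf hg, dd_const] at h1
  linarith

lemma dd_ip_self_const (e : ℝ × ℝ) {U : Set (ℝ × ℝ)} (hU : IsOpen U) {f : ℝ × ℝ → V4}
    {c : ℝ} (h : ∀ p ∈ U, ip (f p) (f p) = c) {p : ℝ × ℝ} (hp : p ∈ U)
    (hf : DifferentiableAt ℝ f p) : ip (dd e f p) (f p) = 0 := by
  have h1 := dd_ip_const e hU h hp hf hf
  rw [ip_comm (f p)] at h1
  linarith

/-- The facts about the null derivatives of a minimal time-like surface in canonical coordinates
that do not involve its curvatures. -/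
structure NullData (U : Set (ℝ × ℝ)) (x : ℝ × ℝ → V4) : Prop where
  smooth : ∀ p ∈ U, ContDiffAt ℝ ∞ x p
  minimal : ∀ p ∈ U, dd et (dd es x) p = 0
  aa : ∀ p ∈ U, ip (dd es x p) (dd es x p) = 0
  bb : ∀ p ∈ U, ip (dd et x p) (dd et x p) = 0
  neg : ∀ p ∈ U, ip (dd es x p) (dd et x p) < 0
  ha : ∀ p ∈ U, ip (dd es (dd es x) p) (dd es x p) = 0
  hb : ∀ p ∈ U, ip (dd et (dd et x) p) (dd et x p) = 0
  haa : ∀ p ∈ U, ip (dd es (dd es x) p) (dd es (dd es x) p) = 1 / 4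
  hbb : ∀ p ∈ U, ip (dd et (dd et x) p) (dd et (dd et x) p) = 1 / 4

lemma NullData.mono {U V : Set (ℝ × ℝ)} {x : ℝ × ℝ → V4} (h : NullData U x) (hV : V ⊆ U) :
    NullData V x where
  smooth p hp := h.smooth p (hV hp)
  minimal p hp := h.minimal p (hV hp)
  aa p hp := h.aa p (hV hp)
  bb p hp := h.bb p (hV hp)
  neg p hp := h.neg p (hV hp)
  ha p hp := h.ha p (hV hp)
  hb p hp := h.hb p (hV hp)
  haa p hp := h.haa p (hV hp)
  hbb p hp := h.hbb p (hV hp)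

lemma NullData.goodSurf {U : Set (ℝ × ℝ)} {x : ℝ × ℝ → V4} (h : NullData U x) :
    GoodSurf U x := by
  refine ⟨fun p hp => (h.smooth p hp).contDiffWithinAt, fun p hp => ?_, fun p hp => ?_,
    fun p hp => ?_⟩
  · have hE := Ef_eq (h.aa p hp) (h.bb p hp)
    have := h.neg p hp
    refine ⟨by linarith, ?_, ?_⟩
    · rw [hE, pv_eq]
      simp only [ip_sub_left, ip_sub_right, h.aa p hp, h.bb p hp, ip_comm (dd et x p) (dd es x p)]
      ring
    · rw [pu_eq, pv_eq]
      simp only [ip_sub_right, ip_add_left, h.aa p hp, h.bb p hp, ip_comm (dd et x p) (dd es x p)]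
      ring
  · rw [pu_pu_sub_pv_pv (h.smooth p hp), h.minimal p hp, smul_zero]
  · exact (canonical_iff (h.smooth p hp) (h.minimal p hp) (h.aa p hp) (h.bb p hp) (h.ha p hp)
      (h.hb p hp)).2 ⟨h.haa p hp, h.hbb p hp⟩

lemma GoodSurf.nullData {U : Set (ℝ × ℝ)} (hU : IsOpen U) {x : ℝ × ℝ → V4} (h : GoodSurf U x) :
    NullData U x := by
  obtain ⟨hx, hiso, hmin, hcan⟩ := h
  have hs : ∀ p ∈ U, ContDiffAt ℝ ∞ x p := fun p hp => (hx p hp).contDiffAt (hU.mem_nhds hp)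
  have hα := fun p hp => smooth_differentiableAt (contDiffAt_dd (hs p hp) es)
  have hβ := fun p hp => smooth_differentiableAt (contDiffAt_dd (hs p hp) et)
  have hm : ∀ p ∈ U, dd et (dd es x) p = 0 := fun p hp => by
    have := hmin p hp
    rw [pu_pu_sub_pv_pv (hs p hp)] at this
    simpa using this
  have key : ∀ p ∈ U, ip (dd es x p) (dd es x p) = 0 ∧ ip (dd et x p) (dd et x p) = 0 ∧
      ip (dd es x p) (dd et x p) < 0 := fun p hp => by
    obtain ⟨h1, h2, h3⟩ := hiso p hp
    simp only [Ef, pu_eq, pv_eq, ip_add_left, ip_add_right, ip_sub_left, ip_sub_right,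
      ip_comm (dd et x p) (dd es x p)] at h1 h2 h3
    exact ⟨by linarith, by linarith, by linarith⟩
  have aa := fun p hp => (key p hp).1
  have bb := fun p hp => (key p hp).2.1
  have ha := fun p hp => dd_ip_self_const es hU aa hp (hα p hp)
  have hb := fun p hp => dd_ip_self_const et hU bb hp (hβ p hp)
  have hc := fun p hp => (canonical_iff (hs p hp) (hm p hp) (aa p hp) (bb p hp) (ha p hp)
      (hb p hp)).1 (hcan p hp)
  exact ⟨hs, hm, aa, bb, fun p hp => (key p hp).2.2, ha, hb, fun p hp => (hc p hp).1,
    fun p hp => (hc p hp).2⟩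

/-- A moving frame satisfying the structure equations of a minimal time-like surface. -/
structure MovingFrame (U : Set (ℝ × ℝ)) (P C S : ℝ × ℝ → ℝ) (α β n m : ℝ × ℝ → V4) : Prop where
  frame : ∀ p ∈ U, IsFrame (P p) (α p) (β p) (n p) (m p)
  smooth_α : ∀ p ∈ U, ContDiffAt ℝ ∞ α p
  smooth_β : ∀ p ∈ U, ContDiffAt ℝ ∞ β p
  smooth_n : ∀ p ∈ U, ContDiffAt ℝ ∞ n p
  smooth_m : ∀ p ∈ U, ContDiffAt ℝ ∞ m p
  sα : ∀ p ∈ U, dd es α p = (dd es P p / P p) • α p + (1 / 2 : ℝ) • n p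
  tα : ∀ p ∈ U, dd et α p = 0
  sβ : ∀ p ∈ U, dd es β p = 0
  tβ : ∀ p ∈ U, dd et β p = (dd et P p / P p) • β p + (1 / 2 : ℝ) • (C p • n p + S p • m p)
  sn : ∀ p ∈ U, dd es n p = (-(2 * P p)⁻¹) • β p - (dd es S p / C p) • m p
  tn : ∀ p ∈ U, dd et n p = (-(C p / (2 * P p))) • α p
  sm : ∀ p ∈ U, dd es m p = -(dd es S p / C p) • n p
  tm : ∀ p ∈ U, dd et m p = (S p / (2 * P p)) • α p

lemma contDiffAt_cross {f g h : ℝ × ℝ → V4} {p : ℝ × ℝ} (hf : ContDiffAt ℝ ∞ f p)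
    (hg : ContDiffAt ℝ ∞ g p) (hh : ContDiffAt ℝ ∞ h p) :
    ContDiffAt ℝ ∞ (fun q => cross (f q) (g q) (h q)) p := by
  have hf := contDiffAt_pi.1 hf
  have hg := contDiffAt_pi.1 hg
  have hh := contDiffAt_pi.1 hh
  have key (i j k : Fin 4) : ContDiffAt ℝ ∞ (fun q => minor (f q) (g q) (h q) i j k) p :=
    (((hf i).mul (((hg j).mul (hh k)).sub ((hg k).mul (hh j)))).sub
      ((hf j).mul (((hg i).mul (hh k)).sub ((hg k).mul (hh i))))).add
      ((hf k).mul (((hg i).mul (hh j)).sub ((hg j).mul (hh i))))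
  refine contDiffAt_pi.2 fun i => ?_
  fin_cases i
  exacts [key 1 2 3, key 0 2 3, key 0 1 3, key 0 1 2]

/-- The first unit normal of a minimal time-like surface in canonical coordinates. -/
def unitNormal (x : ℝ × ℝ → V4) (p : ℝ × ℝ) : V4 :=
  nullNormal (dd es x p) (dd et x p) (dd es (dd es x) p)

/-- The second unit normal of a minimal time-like surface in canonical coordinates. -/
def unitNormal' (x : ℝ × ℝ → V4) (p : ℝ × ℝ) : V4 :=
  nullNormal (dd et x p) (dd es x p) (dd et (dd et x) p)

/-- The time-like unit normal orthogonal to `unitNormal x`. -/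
def conormal (x : ℝ × ℝ → V4) (p : ℝ × ℝ) : V4 :=
  (ip (dd es x p) (dd et x p))⁻¹ • cross (dd es x p) (dd et x p) (unitNormal x p)

lemma contDiffAt_nullNormal {f g h : ℝ × ℝ → V4} {p : ℝ × ℝ} (hf : ContDiffAt ℝ ∞ f p)
    (hg : ContDiffAt ℝ ∞ g p) (hh : ContDiffAt ℝ ∞ h p) (h0 : ip (f p) (g p) ≠ 0) :
    ContDiffAt ℝ ∞ (fun q => nullNormal (f q) (g q) (h q)) p := by
  have h1 : ContDiffAt ℝ ∞ (fun q => 2 * (ip (h q) (g q) / ip (f q) (g q))) p :=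
    contDiffAt_const.mul ((contDiffAt_ip hh hg).div (contDiffAt_ip hf hg) h0)
  have h2 : ContDiffAt ℝ ∞ (fun q => (2 : ℝ) • h q) p := hh.const_smul (2 : ℝ)
  exact h2.sub (h1.smul hf)

lemma exists_dd_nullNormal {f g h : ℝ × ℝ → V4} {p e : ℝ × ℝ} (hf : ContDiffAt ℝ ∞ f p)
    (hg : ContDiffAt ℝ ∞ g p) (hh : ContDiffAt ℝ ∞ h p) (h0 : ip (f p) (g p) ≠ 0)
    (hf0 : dd e f p = 0) (hh0 : dd e h p = 0) :
    ∃ r : ℝ, dd e (fun q => nullNormal (f q) (g q) (h q)) p = r • f p := by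
  have h1 : ContDiffAt ℝ ∞ (fun q => 2 * (ip (h q) (g q) / ip (f q) (g q))) p :=
    contDiffAt_const.mul ((contDiffAt_ip hh hg).div (contDiffAt_ip hf hg) h0)
  have h2 : ContDiffAt ℝ ∞ (fun q => (2 : ℝ) • h q) p := hh.const_smul (2 : ℝ)
  have h3 : ContDiffAt ℝ ∞ (fun q => (2 * (ip (h q) (g q) / ip (f q) (g q))) • f q) p := h1.smul hf
  refine ⟨-dd e (fun q => 2 * (ip (h q) (g q) / ip (f q) (g q))) p, ?_⟩
  simp only [nullNormal]
  rw [dd_sub e (smooth_differentiableAt h2) (smooth_differentiableAt h3),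
    dd_smul e (differentiableAt_const _) (smooth_differentiableAt hh),
    dd_smul e (smooth_differentiableAt h1) (smooth_differentiableAt hf), hf0, hh0, dd_const]
  module

namespace NullData

variable {U : Set (ℝ × ℝ)} {x : ℝ × ℝ → V4} {p : ℝ × ℝ}

lemma frame (h : NullData U x) (hp : p ∈ U) : IsFrame (ip (dd es x p) (dd et x p)) (dd es x p)
    (dd et x p) (unitNormal x p) (conormal x p) := by
  refine isFrame_cross (h.neg p hp).ne (h.aa p hp) (h.bb p hp) rfl
    (ip_nullNormal_left (h.aa p hp) (h.ha p hp)) (ip_nullNormal_right _ (h.neg p hp).ne) ?_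
  rw [unitNormal, ip_nullNormal_self (h.aa p hp) (h.ha p hp), h.haa p hp]
  norm_num

lemma unitNormal'_self (h : NullData U x) (hp : p ∈ U) :
    ip (unitNormal' x p) (unitNormal' x p) = 1 := by
  rw [unitNormal', ip_nullNormal_self (h.bb p hp) (h.hb p hp), h.hbb p hp]
  norm_num

lemma ip_normals (h : NullData U x) (hp : p ∈ U) : ip (unitNormal x p) (unitNormal' x p) =
    -4 * GaussK x p * ip (dd es x p) (dd et x p) ^ 2 := by
  rw [GaussK_eq (h.smooth p hp) (h.minimal p hp) (h.aa p hp) (h.bb p hp) (h.ha p hp) (h.hb p hp),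
    Ef_eq (h.aa p hp) (h.bb p hp), ← unitNormal, ← unitNormal']
  field_simp [(h.neg p hp).ne]
  ring

lemma unitNormal'_conormal (h : NullData U x) (hp : p ∈ U) :
    ip (unitNormal' x p) (conormal x p) =
    -4 * NormK x p * ip (dd es x p) (dd et x p) ^ 2 := by
  rw [NormK_eq (h.smooth p hp) (h.minimal p hp) (h.aa p hp) (h.bb p hp) (h.ha p hp) (h.hb p hp),
    Ef_eq (h.aa p hp) (h.bb p hp), ← unitNormal, ← unitNormal', conormal, ip_smul_right,
    ip_comm _ (cross _ _ _), ip_cross]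
  field_simp [(h.neg p hp).ne]
  ring

lemma unitNormal'_eq (h : NullData U x) (hp : p ∈ U) : unitNormal' x p =
    (-4 * GaussK x p * ip (dd es x p) (dd et x p) ^ 2) • unitNormal x p +
      (4 * NormK x p * ip (dd es x p) (dd et x p) ^ 2) • conormal x p := by
  have F := h.frame hp
  have h0 : ip (dd et x p) (dd es x p) ≠ 0 := by rw [ip_comm]; exact F.ne
  rw [← h.ip_normals hp]
  refine F.ext_ip ?_ ?_ ?_ ?_ <;> simp only [ip_add_left, ip_smul_left]
  · rw [F.na, F.ma, unitNormal', ip_nullNormal_right _ h0]; ring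
  · rw [F.nb, F.mb, unitNormal', ip_nullNormal_left (h.bb p hp) (h.hb p hp)]; ring
  · rw [F.nn, F.mn, ip_comm]; ring
  · rw [F.mm, ip_comm (unitNormal x p) (conormal x p), F.mn, h.unitNormal'_conormal hp]; ring

lemma curvature_relation (h : NullData U x) (hp : p ∈ U) :
    16 * ip (dd es x p) (dd et x p) ^ 4 * (GaussK x p ^ 2 - NormK x p ^ 2) = 1 := by
  have F := h.frame hp
  have h1 := h.unitNormal'_self hp
  rw [h.unitNormal'_eq hp] at h1
  simp only [ip_add_left, ip_add_right, ip_smul_left, ip_smul_right, F.nn, F.mm, F.mn,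
    ip_comm (unitNormal x p) (conormal x p)] at h1
  linarith

end NullData


lemma NullData.movingFrame {U : Set (ℝ × ℝ)} (hU : IsOpen U) {x : ℝ × ℝ → V4}
    (h : NullData U x) {P C S : ℝ × ℝ → ℝ}
    (hP : ∀ p ∈ U, ip (dd es x p) (dd et x p) = P p)
    (hC : ∀ p ∈ U, C p = -4 * GaussK x p * P p ^ 2)
    (hS : ∀ p ∈ U, S p = 4 * NormK x p * P p ^ 2) :
    MovingFrame U P C S (dd es x) (dd et x) (unitNormal x) (conormal x) := by
  have cα : ∀ p ∈ U, ContDiffAt ℝ ∞ (dd es x) p := fun p hp => contDiffAt_dd (h.smooth p hp) _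
  have cβ : ∀ p ∈ U, ContDiffAt ℝ ∞ (dd et x) p := fun p hp => contDiffAt_dd (h.smooth p hp) _
  have cP : ∀ p ∈ U, ContDiffAt ℝ ∞ (fun q => ip (dd es x q) (dd et x q)) p :=
    fun p hp => contDiffAt_ip (cα p hp) (cβ p hp)
  have cn : ∀ p ∈ U, ContDiffAt ℝ ∞ (unitNormal x) p := fun p hp =>
    contDiffAt_nullNormal (cα p hp) (cβ p hp) (contDiffAt_dd (cα p hp) _) (h.neg p hp).ne
  have cn' : ∀ p ∈ U, ContDiffAt ℝ ∞ (unitNormal' x) p := fun p hp =>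
    contDiffAt_nullNormal (cβ p hp) (cα p hp) (contDiffAt_dd (cβ p hp) _)
      (by rw [ip_comm]; exact (h.neg p hp).ne)
  have cm : ∀ p ∈ U, ContDiffAt ℝ ∞ (conormal x) p := fun p hp =>
    ((cP p hp).inv (h.neg p hp).ne).smul (contDiffAt_cross (cα p hp) (cβ p hp) (cn p hp))
  have dα := fun p hp => smooth_differentiableAt (cα p hp)
  have dβ := fun p hp => smooth_differentiableAt (cβ p hp)
  have dn := fun p hp => smooth_differentiableAt (cn p hp)
  have dn' := fun p hp => smooth_differentiableAt (cn' p hp)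
  have dm := fun p hp => smooth_differentiableAt (cm p hp)
  have frame : ∀ p ∈ U, IsFrame (P p) (dd es x p) (dd et x p) (unitNormal x p) (conormal x p) :=
    fun p hp => hP p hp ▸ h.frame hp
  have tα := h.minimal
  have sβ : ∀ p ∈ U, dd es (dd et x) p = 0 := fun p hp => by
    rw [dd_comm (h.smooth p hp), tα p hp]
  have sP : ∀ p ∈ U, dd es P p = ip (dd es (dd es x) p) (dd et x p) := fun p hp => by
    rw [← dd_congr hU hP es hp, dd_ip _ (dα p hp) (dβ p hp), sβ p hp]; simp [ip]
  have tP : ∀ p ∈ U, dd et P p = ip (dd et (dd et x) p) (dd es x p) := fun p hp => by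
    rw [← dd_congr hU hP et hp, dd_ip _ (dα p hp) (dβ p hp), tα p hp, ip_comm (dd es x p)]
    simp [ip]
  have sα : ∀ p ∈ U, dd es (dd es x) p =
      (dd es P p / P p) • dd es x p + (1 / 2 : ℝ) • unitNormal x p := fun p hp => by
    rw [unitNormal, half_nullNormal, sP p hp, hP p hp]; module
  have n'_eq : ∀ p ∈ U, unitNormal' x p = C p • unitNormal x p + S p • conormal x p :=
    fun p hp => by rw [h.unitNormal'_eq hp, hC p hp, hS p hp, hP p hp]
  have tβ : ∀ p ∈ U, dd et (dd et x) p = (dd et P p / P p) • dd et x p +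
      (1 / 2 : ℝ) • (C p • unitNormal x p + S p • conormal x p) := fun p hp => by
    rw [← n'_eq p hp, unitNormal', half_nullNormal, tP p hp, ip_comm (dd et x p), hP p hp]; module
  have na := fun p hp => (frame p hp).na
  have nb := fun p hp => (frame p hp).nb
  have nn := fun p hp => (frame p hp).nn
  have ma := fun p hp => (frame p hp).ma
  have mb := fun p hp => (frame p hp).mb
  have mn := fun p hp => (frame p hp).mn
  have mm := fun p hp => (frame p hp).mm
  have sn' : ∀ p ∈ U, ip (dd es (unitNormal' x) p) (conormal x p) = 0 := fun p hp => by
    obtain ⟨r, hr⟩ := exists_dd_nullNormal (e := es) (cβ p hp) (cα p hp)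
      (contDiffAt_dd (cβ p hp) et) (by rw [ip_comm]; exact (h.neg p hp).ne) (sβ p hp)
      (by rw [dd_comm (cβ p hp), dd_congr hU sβ et hp, dd_const])
    change ip (dd es (fun q => nullNormal (dd et x q) (dd es x q) (dd et (dd et x) q)) p) _ = 0
    rw [hr, ip_smul_left, ip_comm, mb p hp, mul_zero]
  have tn : ∀ p ∈ U, ip (dd et (unitNormal x) p) (conormal x p) = 0 := fun p hp => by
    obtain ⟨r, hr⟩ := exists_dd_nullNormal (e := et) (cα p hp) (cβ p hp)
      (contDiffAt_dd (cα p hp) es) (h.neg p hp).ne (tα p hp)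
      (by rw [dd_comm (cα p hp), dd_congr hU tα es hp, dd_const])
    change ip (dd et (fun q => nullNormal (dd es x q) (dd et x q) (dd es (dd es x) q)) p) _ = 0
    rw [hr, ip_smul_left, ip_comm, ma p hp, mul_zero]
  have C0 : ∀ p ∈ U, C p ≠ 0 := fun p hp h0 => by
    have h1 := h.curvature_relation hp
    rw [hP p hp] at h1
    rw [hC p hp] at h0
    nlinarith [sq_nonneg (P p ^ 2 * NormK x p)]
  have hCn : ∀ p ∈ U, ip (unitNormal' x p) (unitNormal x p) = C p := fun p hp => by
    rw [n'_eq p hp, ip_add_left, ip_smul_left, ip_smul_left, nn p hp, mn p hp]; ring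
  have hSm : ∀ p ∈ U, ip (unitNormal' x p) (conormal x p) = -S p := fun p hp => by
    rw [n'_eq p hp, ip_add_left, ip_smul_left, ip_smul_left, ip_comm (unitNormal x p), mm p hp,
      mn p hp]; ring
  have sm : ∀ p ∈ U, dd es (conormal x) p = -(dd es S p / C p) • unitNormal x p := fun p hp => by
    have e1 : dd es (conormal x) p = ip (dd es (conormal x) p) (unitNormal x p) •
        unitNormal x p := by
      refine (frame p hp).ext_ip ?_ ?_ ?_ ?_ <;> simp only [ip_smul_left]
      · rw [dd_ip_const es hU ma hp (dm p hp) (dα p hp), na p hp, sα p hp, ip_add_right,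
          ip_smul_right, ip_smul_right, ma p hp, mn p hp]; ring
      · rw [dd_ip_const es hU mb hp (dm p hp) (dβ p hp), nb p hp, sβ p hp]; simp [ip]
      · rw [nn p hp]; ring
      · rw [dd_ip_self_const es hU mm hp (dm p hp), ip_comm (unitNormal x p), mn p hp]; ring
    have e2 : dd es S p = -(C p * ip (dd es (conormal x) p) (unitNormal x p)) := by
      have e4 : dd es (fun q => ip (unitNormal' x q) (conormal x q)) p = - dd es S p := by
        rw [dd_congr hU hSm es hp]; simp [dd]
      rw [dd_ip es (dn' p hp) (dm p hp), sn' p hp] at e4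
      conv at e4 => lhs; rw [e1]
      rw [ip_smul_right, hCn p hp] at e4
      linarith
    rw [e1, e2]
    congr 1
    field_simp [C0 p hp]
  have sn : ∀ p ∈ U, dd es (unitNormal x) p =
      (-(2 * P p)⁻¹) • dd et x p - (dd es S p / C p) • conormal x p := fun p hp => by
    refine (frame p hp).ext_ip ?_ ?_ ?_ ?_ <;> simp only [ip_smul_left, ip_sub_left]
    · rw [dd_ip_const es hU na hp (dn p hp) (dα p hp), sα p hp, ip_add_right, ip_comm (dd et x p),
        hP p hp, ma p hp, ip_smul_right, ip_smul_right, na p hp, nn p hp]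
      field_simp [(frame p hp).ne]; ring
    · rw [dd_ip_const es hU nb hp (dn p hp) (dβ p hp), sβ p hp, mb p hp, h.bb p hp]; simp [ip]
    · rw [dd_ip_self_const es hU nn hp (dn p hp), mn p hp, ip_comm (dd et x p), nb p hp]; ring
    · rw [mm p hp, ip_comm (dd et x p), mb p hp, ip_comm, neg_eq_iff_eq_neg.1
        (dd_ip_const es hU mn hp (dm p hp) (dn p hp)).symm, sm p hp, ip_smul_left, nn p hp]
      ring
  refine ⟨frame, cα, cβ, cn, cm, sα, tα, sβ, tβ, sn, fun p hp => ?_, sm, fun p hp => ?_⟩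
  · refine (frame p hp).ext_ip ?_ ?_ ?_ ?_ <;> simp only [ip_smul_left]
    · rw [dd_ip_const et hU na hp (dn p hp) (dα p hp), tα p hp, h.aa p hp]; simp [ip]
    · rw [dd_ip_const et hU nb hp (dn p hp) (dβ p hp), tβ p hp, hP p hp]
      simp only [ip_add_right, ip_smul_right, nn p hp, nb p hp, ip_comm (unitNormal x p)
        (conormal x p), mn p hp]
      field_simp [(frame p hp).ne]; ring
    · rw [dd_ip_self_const et hU nn hp (dn p hp), ip_comm (dd es x p), na p hp]; ring
    · rw [tn p hp, ip_comm (dd es x p), ma p hp]; ring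
  · refine (frame p hp).ext_ip ?_ ?_ ?_ ?_ <;> simp only [ip_smul_left]
    · rw [dd_ip_const et hU ma hp (dm p hp) (dα p hp), tα p hp, h.aa p hp]; simp [ip]
    · rw [dd_ip_const et hU mb hp (dm p hp) (dβ p hp), tβ p hp, hP p hp]
      simp only [ip_add_right, ip_smul_right, mm p hp, mb p hp, mn p hp]
      field_simp [(frame p hp).ne]; ring
    · rw [dd_ip_const et hU mn hp (dm p hp) (dn p hp), ip_comm, tn p hp, ip_comm (dd es x p),
        na p hp]; ring
    · rw [dd_ip_self_const et hU mm hp (dm p hp), ip_comm (dd es x p), ma p hp]; ring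


lemma dd_frameMap (e : ℝ × ℝ) {P : ℝ × ℝ → ℝ} {α β n m α' β' n' m' : ℝ × ℝ → V4}
    {p : ℝ × ℝ} (v : V4) (h0 : P p ≠ 0) (hP : ContDiffAt ℝ ∞ P p)
    (hα : ContDiffAt ℝ ∞ α p) (hβ : ContDiffAt ℝ ∞ β p) (hn : ContDiffAt ℝ ∞ n p)
    (hm : ContDiffAt ℝ ∞ m p) (hα' : ContDiffAt ℝ ∞ α' p) (hβ' : ContDiffAt ℝ ∞ β' p)
    (hn' : ContDiffAt ℝ ∞ n' p) (hm' : ContDiffAt ℝ ∞ m' p) :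
    dd e (fun q => IsFrame.map (P q) (α q) (β q) (n q) (m q) (α' q) (β' q) (n' q) (m' q) v) p =
      ((P p)⁻¹ * ip v (dd e β p) - dd e P p / P p ^ 2 * ip v (β p)) • α' p
      + ((P p)⁻¹ * ip v (β p)) • dd e α' p
      + ((P p)⁻¹ * ip v (dd e α p) - dd e P p / P p ^ 2 * ip v (α p)) • β' p
      + ((P p)⁻¹ * ip v (α p)) • dd e β' p
      + ip v (dd e n p) • n' p + ip v (n p) • dd e n' p
      - ip v (dd e m p) • m' p - ip v (m p) • dd e m' p := by
  have hv : ContDiffAt ℝ ∞ (fun _ : ℝ × ℝ => v) p := contDiffAt_const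
  have D {f : ℝ × ℝ → V4} (hf : ContDiffAt ℝ ∞ f p) := smooth_differentiableAt hf
  have I : ContDiffAt ℝ ∞ (fun q => (P q)⁻¹) p := hP.inv h0
  have cβ : ContDiffAt ℝ ∞ (fun q => (P q)⁻¹ * ip v (β q)) p := I.mul (contDiffAt_ip hv hβ)
  have cα : ContDiffAt ℝ ∞ (fun q => (P q)⁻¹ * ip v (α q)) p := I.mul (contDiffAt_ip hv hα)
  have cn := contDiffAt_ip hv hn
  have cm := contDiffAt_ip hv hm
  have t1 : ContDiffAt ℝ ∞ (fun q => ((P q)⁻¹ * ip v (β q)) • α' q) p := cβ.smul hα'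
  have t2 : ContDiffAt ℝ ∞ (fun q => ((P q)⁻¹ * ip v (α q)) • β' q) p := cα.smul hβ'
  have t3 : ContDiffAt ℝ ∞ (fun q => ip v (n q) • n' q) p := cn.smul hn'
  have t4 : ContDiffAt ℝ ∞ (fun q => ip v (m q) • m' q) p := cm.smul hm'
  have hip {f : ℝ × ℝ → V4} (hf : ContDiffAt ℝ ∞ f p) :
      dd e (fun q => ip v (f q)) p = ip v (dd e f p) := by
    rw [dd_ip e (D hv) (D hf), dd_const]; simp [ip]
  simp only [IsFrame.map]
  rw [dd_sub e (D ((t1.add t2).add t3)) (D t4), dd_add e (D (t1.add t2)) (D t3),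
    dd_add e (D t1) (D t2), dd_smul e (smooth_differentiableAt cβ) (D hα'),
    dd_smul e (smooth_differentiableAt cα) (D hβ'), dd_smul e (smooth_differentiableAt cn) (D hn'),
    dd_smul e (smooth_differentiableAt cm) (D hm'),
    dd_mul e (smooth_differentiableAt I) (smooth_differentiableAt (contDiffAt_ip hv hβ)),
    dd_mul e (smooth_differentiableAt I) (smooth_differentiableAt (contDiffAt_ip hv hα)),
    dd_inv e (smooth_differentiableAt hP) h0, hip hα, hip hβ, hip hn, hip hm]
  module

lemma fderiv_eq_zero_of_dd {E : Type*} [NormedAddCommGroup E] [NormedSpace ℝ E]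
    {f : ℝ × ℝ → E} {p : ℝ × ℝ} (hs : dd es f p = 0) (ht : dd et f p = 0) :
    fderiv ℝ f p = 0 := by
  ext <;> simp
  · have := pu_eq f p
    rw [hs, ht, add_zero] at this
    exact this
  · have := pv_eq f p
    rw [hs, ht, sub_zero] at this
    exact this

lemma MovingFrame.fderiv_frameMap {U : Set (ℝ × ℝ)} (hU : IsOpen U) {P C S : ℝ × ℝ → ℝ}
    {α β n m α' β' n' m' : ℝ × ℝ → V4} (F : MovingFrame U P C S α β n m)
    (F' : MovingFrame U P C S α' β' n' m') (v : V4) {p : ℝ × ℝ} (hp : p ∈ U) :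
    DifferentiableAt ℝ (fun q =>
      IsFrame.map (P q) (α q) (β q) (n q) (m q) (α' q) (β' q) (n' q) (m' q) v) p ∧
    fderiv ℝ (fun q =>
      IsFrame.map (P q) (α q) (β q) (n q) (m q) (α' q) (β' q) (n' q) (m' q) v) p = 0 := by
  have h0 := (F.frame p hp).ne
  have hP : ContDiffAt ℝ ∞ P p :=
    (contDiffAt_ip (F.smooth_α p hp) (F.smooth_β p hp)).congr_of_eventuallyEq
      (Filter.eventually_of_mem (hU.mem_nhds hp) fun q hq => (F.frame q hq).ab.symm)
  have key e := dd_frameMap e v h0 hP (F.smooth_α p hp) (F.smooth_β p hp) (F.smooth_n p hp)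
    (F.smooth_m p hp) (F'.smooth_α p hp) (F'.smooth_β p hp) (F'.smooth_n p hp) (F'.smooth_m p hp)
  constructor
  · have hv : ContDiffAt ℝ ∞ (fun _ : ℝ × ℝ => v) p := contDiffAt_const
    have I := hP.inv h0
    exact smooth_differentiableAt (((((I.mul (contDiffAt_ip hv (F.smooth_β p hp))).smul
      (F'.smooth_α p hp)).add ((I.mul (contDiffAt_ip hv (F.smooth_α p hp))).smul
      (F'.smooth_β p hp))).add ((contDiffAt_ip hv (F.smooth_n p hp)).smul
      (F'.smooth_n p hp))).sub ((contDiffAt_ip hv (F.smooth_m p hp)).smul (F'.smooth_m p hp)))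
  · refine fderiv_eq_zero_of_dd ?_ ?_
    · rw [key, F.sα p hp, F.sβ p hp, F.sn p hp, F.sm p hp, F'.sα p hp, F'.sβ p hp, F'.sn p hp,
        F'.sm p hp]
      simp only [ip_add_right, ip_sub_right, ip_smul_right]
      ext i
      simp [ip]
      field_simp
      ring
    · rw [key, F.tα p hp, F.tβ p hp, F.tn p hp, F.tm p hp, F'.tα p hp, F'.tβ p hp, F'.tn p hp,
        F'.tm p hp]
      simp only [ip_add_right, ip_smul_right]
      ext i
      simp [ip]
      field_simp
      ring

theorem rigidity {U : Set (ℝ × ℝ)} (hU : IsOpen U) {x x' : ℝ × ℝ → V4} (h : NullData U x)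
    (h' : NullData U x') (hK : ∀ p ∈ U, GaussK x p = GaussK x' p)
    (hκ : ∀ p ∈ U, NormK x p = NormK x' p) {p₀ : ℝ × ℝ} (hp₀ : p₀ ∈ U) :
    ∃ (V : Set (ℝ × ℝ)) (A : V4 →ₗ[ℝ] V4) (c : V4), IsOpen V ∧ p₀ ∈ V ∧ V ⊆ U ∧
      (∀ v w : V4, ip (A v) (A w) = ip v w) ∧ LinearMap.det A = 1 ∧
      ∀ p ∈ V, x' p = A (x p) + c := by
  obtain ⟨r, hr, hV⟩ := Metric.isOpen_iff.1 hU p₀ hp₀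
  have hconn : IsPreconnected (Metric.ball p₀ r) := (convex_ball p₀ r).isPreconnected
  have hP : ∀ p ∈ U, ip (dd es x' p) (dd et x' p) = ip (dd es x p) (dd et x p) := fun p hp => by
    have h1 := h.curvature_relation hp
    have h2 := h'.curvature_relation hp
    rw [← hK p hp, ← hκ p hp] at h2
    have h3 : GaussK x p ^ 2 - NormK x p ^ 2 ≠ 0 := fun h0 => by simp [h0] at h1
    have h4 : ip (dd es x' p) (dd et x' p) ^ 4 = ip (dd es x p) (dd et x p) ^ 4 :=
      mul_right_cancel₀ h3 (by linarith)
    have h5 : |ip (dd es x' p) (dd et x' p)| = |ip (dd es x p) (dd et x p)| := by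
      rw [← pow_left_inj₀ (abs_nonneg _) (abs_nonneg _) (n := 4) (by norm_num)]
      simpa [Even.pow_abs (show Even 4 by decide)] using h4
    rw [abs_of_neg (h.neg p hp), abs_of_neg (h'.neg p hp)] at h5
    linarith
  have F := h.movingFrame hU (P := fun p => ip (dd es x p) (dd et x p)) (fun p _ => rfl)
    (C := fun p => -4 * GaussK x p * ip (dd es x p) (dd et x p) ^ 2) (fun p _ => rfl)
    (S := fun p => 4 * NormK x p * ip (dd es x p) (dd et x p) ^ 2) (fun p _ => rfl)
  have F' := h'.movingFrame hU hP
    (C := fun p => -4 * GaussK x p * ip (dd es x p) (dd et x p) ^ 2)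
    (fun p hp => by rw [hK p hp])
    (S := fun p => 4 * NormK x p * ip (dd es x p) (dd et x p) ^ 2)
    (fun p hp => by rw [hκ p hp])
  obtain ⟨A, hA, hdet⟩ := (F.frame p₀ hp₀).exists_linearMap (F'.frame p₀ hp₀)
  have hp₀' : p₀ ∈ Metric.ball p₀ r := Metric.mem_ball_self hr
  have hconst : ∀ p ∈ Metric.ball p₀ r, ∀ v, A v = IsFrame.map _ (dd es x p) (dd et x p)
      (unitNormal x p) (conormal x p) (dd es x' p) (dd et x' p) (unitNormal x' p)
      (conormal x' p) v := fun p hp v => by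
    rw [hA]
    exact Metric.isOpen_ball.is_const_of_fderiv_eq_zero hconn
      (fun q hq => (F.fderiv_frameMap hU F' v (hV hq)).1.differentiableWithinAt)
      (fun q hq => (F.fderiv_frameMap hU F' v (hV hq)).2) hp₀' hp
  have hderiv : ∀ p ∈ Metric.ball p₀ r, HasFDerivAt (fun q => A (x q))
      ((LinearMap.toContinuousLinearMap A).comp (fderiv ℝ x p)) p := fun p hp =>
    (LinearMap.toContinuousLinearMap A).hasFDerivAt.comp p
      (smooth_differentiableAt (h.smooth p (hV hp))).hasFDerivAt
  have hdd : ∀ p ∈ Metric.ball p₀ r, ∀ e, dd e (fun q => x' q - A (x q)) p =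
      dd e x' p - A (dd e x p) := fun p hp e => by
    rw [dd_sub e (smooth_differentiableAt (h'.smooth p (hV hp))) (hderiv p hp).differentiableAt]
    simp only [dd]
    rw [(hderiv p hp).fderiv]
    rfl
  refine ⟨Metric.ball p₀ r, A, x' p₀ - A (x p₀), Metric.isOpen_ball, hp₀', hV, fun v w => ?_,
    hdet, fun p hp => ?_⟩
  · rw [hA, hA]
    exact (F.frame p₀ hp₀).ip_map (F'.frame p₀ hp₀) v w
  · have hc : x' p₀ - A (x p₀) = x' p - A (x p) :=
      Metric.isOpen_ball.is_const_of_fderiv_eq_zero (f := fun q => x' q - A (x q)) hconn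
        (fun q hq => ((smooth_differentiableAt (h'.smooth q (hV hq))).sub
          (hderiv q hq).differentiableAt).differentiableWithinAt)
        (fun q hq => fderiv_eq_zero_of_dd
          (by rw [hdd q hq, hconst q hq, (F.frame q (hV hq)).map_left, sub_self])
          (by rw [hdd q hq, hconst q hq, (F.frame q (hV hq)).map_right, sub_self])) hp₀' hp
    rw [hc]; abel

end Rigidity

section Liouville

lemma dd_exp (e : ℝ × ℝ) {f : ℝ × ℝ → ℝ} {p : ℝ × ℝ} (hf : DifferentiableAt ℝ f p) :
    dd e (fun q => Real.exp (f q)) p = Real.exp (f p) * dd e f p := by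
  simp [dd, fderiv_exp hf]

/-- The Liouville equation for `X`, written as a bilinear equation for `exp (X / 2)`. -/
lemma liouville_bilinear {D : Set (ℝ × ℝ)} (hD : IsOpen D) {X : ℝ × ℝ → ℝ} {σ : ℝ} {e e' : ℝ × ℝ}
    (hX : ∀ p ∈ D, ContDiffAt ℝ ∞ X p)
    (hL : ∀ p ∈ D, dd e (dd e' X) p = σ / 2 * Real.exp (-X p)) {p : ℝ × ℝ} (hp : p ∈ D) :
    Real.exp (X p / 2) * dd e (dd e' fun q => Real.exp (X q / 2)) p -
      dd e (fun q => Real.exp (X q / 2)) p * dd e' (fun q => Real.exp (X q / 2)) p = σ / 4 := by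
  have hY : ∀ q ∈ D, ContDiffAt ℝ ∞ (fun q => X q / 2) q := fun q hq => (hX q hq).div_const 2
  have hYd (e : ℝ × ℝ) : ∀ q ∈ D, dd e (fun q => X q / 2) q = 1 / 2 * dd e X q := fun q hq => by
    have : (fun q => X q / 2) = fun q => (1 / 2) * X q := by ext; ring
    rw [this, dd_mul e (differentiableAt_const _) (smooth_differentiableAt (hX q hq)), dd_const]
    ring
  have h1 (e : ℝ × ℝ) : ∀ q ∈ D, dd e (fun q => Real.exp (X q / 2)) q =
      Real.exp (X q / 2) * (1 / 2 * dd e X q) := fun q hq => by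
    rw [dd_exp e (smooth_differentiableAt (hY q hq)), hYd e q hq]
  have hd := smooth_differentiableAt (contDiffAt_dd (hX p hp) e')
  have hX2 : Real.exp (X p / 2) * Real.exp (X p / 2) * Real.exp (-X p) = 1 := by
    rw [← Real.exp_add, ← Real.exp_add]; ring_nf; exact Real.exp_zero
  have hd' : DifferentiableAt ℝ (fun q => 1 / 2 * dd e' X q) p := hd.const_mul _
  have he : DifferentiableAt ℝ (fun q => Real.exp (X q / 2)) p :=
    (smooth_differentiableAt (hY p hp)).exp
  rw [dd_congr hD (h1 e') e hp, dd_mul e he hd', dd_mul e (differentiableAt_const _) hd, dd_const,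
    h1 e p hp, h1 e' p hp, hL p hp]
  linear_combination σ / 4 * hX2

lemma hasDerivAt_slice_fst {g : ℝ × ℝ → ℝ} {s t : ℝ} (hg : DifferentiableAt ℝ g (s, t)) :
    HasDerivAt (fun s => g (s, t)) (dd (1, 0) g (s, t)) s :=
  hg.hasFDerivAt.comp_hasDerivAt s ((hasDerivAt_id s).prodMk (hasDerivAt_const s t))

lemma hasDerivAt_slice_snd {g : ℝ × ℝ → ℝ} {s t : ℝ} (hg : DifferentiableAt ℝ g (s, t)) :
    HasDerivAt (fun t => g (s, t)) (dd (0, 1) g (s, t)) t :=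
  hg.hasFDerivAt.comp_hasDerivAt t ((hasDerivAt_const t s).prodMk (hasDerivAt_id t))

lemma eq_of_hasDerivAt_zero {c r : ℝ} {f : ℝ → ℝ}
    (hf : ∀ s ∈ Metric.ball c r, HasDerivAt f 0 s) {a b : ℝ} (ha : a ∈ Metric.ball c r)
    (hb : b ∈ Metric.ball c r) : f a = f b :=
  Metric.isOpen_ball.is_const_of_deriv_eq_zero (convex_ball c r).isPreconnected
    (fun s hs => (hf s hs).differentiableAt.differentiableWithinAt)
    (fun s hs => (hf s hs).deriv) ha hb

/-- Two planar curves given by the coordinates `f₁, f₂` and `h₁, h₂`, with constant Wronskians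
`1 / 2` and `σ / 2`, whose wedge product is `Ψ`. -/
structure WedgeDecomposition (z : ℝ × ℝ) (r σ : ℝ) (Ψ : ℝ × ℝ → ℝ) (f₁ f₂ h₁ h₂ : ℝ → ℝ) :
    Prop where
  smooth_f₁ : ∀ s ∈ Metric.ball z.1 r, ContDiffAt ℝ ∞ f₁ s
  smooth_f₂ : ∀ s ∈ Metric.ball z.1 r, ContDiffAt ℝ ∞ f₂ s
  smooth_h₁ : ∀ t ∈ Metric.ball z.2 r, ContDiffAt ℝ ∞ h₁ t
  smooth_h₂ : ∀ t ∈ Metric.ball z.2 r, ContDiffAt ℝ ∞ h₂ t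
  wronskian_f : ∀ s ∈ Metric.ball z.1 r, f₁ s * deriv f₂ s - f₂ s * deriv f₁ s = 1 / 2
  wronskian_h : ∀ t ∈ Metric.ball z.2 r, h₁ t * deriv h₂ t - h₂ t * deriv h₁ t = σ / 2
  wedge : ∀ s ∈ Metric.ball z.1 r, ∀ t ∈ Metric.ball z.2 r, f₁ s * h₂ t - f₂ s * h₁ t = Ψ (s, t)

theorem exists_wedgeDecomposition {z : ℝ × ℝ} {r σ : ℝ} (hr : 0 < r) (hσ : σ ^ 2 = 1)
    {Ψ : ℝ × ℝ → ℝ} (hΨ : ∀ p ∈ Metric.ball z r, ContDiffAt ℝ ∞ Ψ p)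
    (h0 : ∀ p ∈ Metric.ball z r, Ψ p ≠ 0)
    (hL : ∀ p ∈ Metric.ball z r,
      Ψ p * dd (1, 0) (dd (0, 1) Ψ) p - dd (1, 0) Ψ p * dd (0, 1) Ψ p = σ / 4) :
    ∃ f₁ f₂ h₁ h₂ : ℝ → ℝ, WedgeDecomposition z r σ Ψ f₁ f₂ h₁ h₂ := by
  obtain ⟨s₀, t₀⟩ := z
  have mem {s t : ℝ} (hs : s ∈ Metric.ball s₀ r) (ht : t ∈ Metric.ball t₀ r) :
      (s, t) ∈ Metric.ball (s₀, t₀) r := by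
    rw [← ball_prod_same]; exact ⟨hs, ht⟩
  have hs₀ : s₀ ∈ Metric.ball s₀ r := Metric.mem_ball_self hr
  have ht₀ : t₀ ∈ Metric.ball t₀ r := Metric.mem_ball_self hr
  have hU : IsOpen (Metric.ball (s₀, t₀) r) := Metric.isOpen_ball
  set Ψs := dd (1, 0) Ψ with hΨs
  set Ψt := dd (0, 1) Ψ with hΨt
  set Ψst := dd (1, 0) Ψt with hΨst
  have cs : ∀ p ∈ Metric.ball (s₀, t₀) r, ContDiffAt ℝ ∞ Ψs p :=
    fun p hp => contDiffAt_dd (hΨ p hp) _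
  have ct : ∀ p ∈ Metric.ball (s₀, t₀) r, ContDiffAt ℝ ∞ Ψt p :=
    fun p hp => contDiffAt_dd (hΨ p hp) _
  have cst : ∀ p ∈ Metric.ball (s₀, t₀) r, ContDiffAt ℝ ∞ Ψst p :=
    fun p hp => contDiffAt_dd (ct p hp) _
  have css : ∀ p ∈ Metric.ball (s₀, t₀) r, ContDiffAt ℝ ∞ (dd (1, 0) Ψs) p :=
    fun p hp => contDiffAt_dd (cs p hp) _
  have hts : ∀ p ∈ Metric.ball (s₀, t₀) r, dd (0, 1) Ψs p = Ψst p :=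
    fun p hp => dd_comm (hΨ p hp) _ _
  have hdL : ∀ p ∈ Metric.ball (s₀, t₀) r,
      Ψ p * dd (1, 0) Ψst p = dd (1, 0) Ψs p * Ψt p := fun p hp => by
    have h1 := dd_congr hU hL (1, 0) hp
    have d := smooth_differentiableAt (hΨ p hp)
    have ds := smooth_differentiableAt (cs p hp)
    have dt := smooth_differentiableAt (ct p hp)
    have dst := smooth_differentiableAt (cst p hp)
    have d₁ : DifferentiableAt ℝ (fun q => Ψ q * Ψst q) p := d.mul dst
    have d₂ : DifferentiableAt ℝ (fun q => Ψs q * Ψt q) p := ds.mul dt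
    rw [dd_sub _ d₁ d₂, dd_mul _ d dst, dd_mul _ ds dt, dd_const] at h1
    linarith
  have htss : ∀ p ∈ Metric.ball (s₀, t₀) r, dd (0, 1) (dd (1, 0) Ψs) p = dd (1, 0) Ψst p :=
    fun p hp => by rw [dd_comm (cs p hp), dd_congr hU hts _ hp]
  have hQ {s t : ℝ} (hs : s ∈ Metric.ball s₀ r) (ht : t ∈ Metric.ball t₀ r) :
      Ψ (s, t) * dd (1, 0) Ψs (s, t₀) = dd (1, 0) Ψs (s, t) * Ψ (s, t₀) := by
    have h1 := eq_of_hasDerivAt_zero (c := t₀) (r := r)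
      (f := fun t => dd (1, 0) Ψs (s, t) / Ψ (s, t)) (fun t ht => by
        have h2 := (hasDerivAt_slice_snd (smooth_differentiableAt (css _ (mem hs ht)))).div
          (hasDerivAt_slice_snd (smooth_differentiableAt (hΨ _ (mem hs ht)))) (h0 _ (mem hs ht))
        convert! h2 using 1
        rw [htss _ (mem hs ht)]
        have := hdL _ (mem hs ht)
        rw [eq_comm, div_eq_zero_iff]
        left
        linarith) ht ht₀
    rw [div_eq_div_iff (h0 _ (mem hs ht)) (h0 _ (mem hs ht₀))] at h1
    linarith
  have hQt {s t : ℝ} (hs : s ∈ Metric.ball s₀ r) (ht : t ∈ Metric.ball t₀ r) :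
      Ψ (s, t) * dd (1, 0) Ψst (s, t₀) = dd (1, 0) Ψs (s, t) * Ψt (s, t₀) := by
    refine mul_left_cancel₀ (h0 _ (mem hs ht₀)) ?_
    linear_combination Ψ (s, t) * hdL _ (mem hs ht₀) + Ψt (s, t₀) * hQ hs ht
  have df {g : ℝ × ℝ → ℝ} (hg : ∀ p ∈ Metric.ball (s₀, t₀) r, ContDiffAt ℝ ∞ g p) {s t : ℝ}
      (hs : s ∈ Metric.ball s₀ r) (ht : t ∈ Metric.ball t₀ r) :=
    hasDerivAt_slice_fst (smooth_differentiableAt (hg _ (mem hs ht)))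
  have dh {g : ℝ × ℝ → ℝ} (hg : ∀ p ∈ Metric.ball (s₀, t₀) r, ContDiffAt ℝ ∞ g p) {s t : ℝ}
      (hs : s ∈ Metric.ball s₀ r) (ht : t ∈ Metric.ball t₀ r) :=
    hasDerivAt_slice_snd (smooth_differentiableAt (hg _ (mem hs ht)))
  have R₁ {s t : ℝ} (hs : s ∈ Metric.ball s₀ r) (ht : t ∈ Metric.ball t₀ r) :
      Ψ (s, t) * Ψs (s, t₀) - Ψs (s, t) * Ψ (s, t₀) =
        Ψ (s₀, t) * Ψs (s₀, t₀) - Ψs (s₀, t) * Ψ (s₀, t₀) :=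
    eq_of_hasDerivAt_zero (f := fun s => Ψ (s, t) * Ψs (s, t₀) - Ψs (s, t) * Ψ (s, t₀))
      (fun s hs => by
        convert! ((df hΨ hs ht).mul (df cs hs ht₀)).sub ((df cs hs ht).mul (df hΨ hs ht₀)) using 1
        linear_combination -hQ hs ht) hs hs₀
  have R₂ {s t : ℝ} (hs : s ∈ Metric.ball s₀ r) (ht : t ∈ Metric.ball t₀ r) :
      Ψ (s, t) * Ψst (s, t₀) - Ψs (s, t) * Ψt (s, t₀) =
        Ψ (s₀, t) * Ψst (s₀, t₀) - Ψs (s₀, t) * Ψt (s₀, t₀) :=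
    eq_of_hasDerivAt_zero (f := fun s => Ψ (s, t) * Ψst (s, t₀) - Ψs (s, t) * Ψt (s, t₀))
      (fun s hs => by
        convert! ((df hΨ hs ht).mul (df cst hs ht₀)).sub ((df cs hs ht).mul (df ct hs ht₀)) using 1
        linear_combination -hQt hs ht) hs hs₀
  have slice_fst {g : ℝ × ℝ → ℝ} (hg : ∀ p ∈ Metric.ball (s₀, t₀) r, ContDiffAt ℝ ∞ g p) {s : ℝ}
      (hs : s ∈ Metric.ball s₀ r) : ContDiffAt ℝ ∞ (fun s => g (s, t₀)) s :=
    (hg _ (mem hs ht₀)).comp s (contDiffAt_id.prodMk contDiffAt_const)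
  have slice_snd {g : ℝ × ℝ → ℝ} (hg : ∀ p ∈ Metric.ball (s₀, t₀) r, ContDiffAt ℝ ∞ g p) {t : ℝ}
      (ht : t ∈ Metric.ball t₀ r) : ContDiffAt ℝ ∞ (fun t => g (s₀, t)) t :=
    (hg _ (mem hs₀ ht)).comp t (contDiffAt_const.prodMk contDiffAt_id)
  refine ⟨fun s => Ψ (s, t₀), fun s => 2 * σ * Ψt (s, t₀),
    fun t => 2 * (Ψ (s₀, t) * Ψs (s₀, t₀) - Ψs (s₀, t) * Ψ (s₀, t₀)),
    fun t => 4 * σ * (Ψ (s₀, t) * Ψst (s₀, t₀) - Ψs (s₀, t) * Ψt (s₀, t₀)),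
    fun s hs => slice_fst hΨ hs, fun s hs => contDiffAt_const.mul (slice_fst ct hs),
    fun t ht => contDiffAt_const.mul (((slice_snd hΨ ht).mul contDiffAt_const).sub
      ((slice_snd cs ht).mul contDiffAt_const)),
    fun t ht => contDiffAt_const.mul (((slice_snd hΨ ht).mul contDiffAt_const).sub
      ((slice_snd cs ht).mul contDiffAt_const)), fun s hs => ?_, fun t ht => ?_,
    fun s hs t ht => ?_⟩
  · rw [(df hΨ hs ht₀).deriv, ((df ct hs ht₀).const_mul (2 * σ)).deriv]
    linear_combination 2 * σ * hL _ (mem hs ht₀) + 1 / 2 * hσ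
  · have k₁ : HasDerivAt (fun t => 2 * (Ψ (s₀, t) * Ψs (s₀, t₀) - Ψs (s₀, t) * Ψ (s₀, t₀))) _ t :=
      (((dh hΨ hs₀ ht).mul_const _).sub ((dh cs hs₀ ht).mul_const _)).const_mul 2
    have k₂ : HasDerivAt
        (fun t => 4 * σ * (Ψ (s₀, t) * Ψst (s₀, t₀) - Ψs (s₀, t) * Ψt (s₀, t₀))) _ t :=
      (((dh hΨ hs₀ ht).mul_const _).sub ((dh cs hs₀ ht).mul_const _)).const_mul (4 * σ)
    rw [k₁.deriv, k₂.deriv, hts _ (mem hs₀ ht)]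
    have h1 := hL _ (mem hs₀ ht)
    have h2 := hL _ (mem hs₀ ht₀)
    linear_combination 8 * σ * (Ψ (s₀, t₀) * Ψst (s₀, t₀) - Ψs (s₀, t₀) * Ψt (s₀, t₀)) * h1
      + 2 * σ ^ 2 * h2 + σ / 2 * hσ
  · have h1 := R₁ hs ht
    have h2 := R₂ hs ht
    have h3 := hL _ (mem hs ht₀)
    linear_combination -4 * σ * Ψ (s, t₀) * h2 + 4 * σ * Ψt (s, t₀) * h1
      + 4 * σ * Ψ (s, t) * h3 + Ψ (s, t) * hσ

end Liouville

section Construction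

/-- The tensor product of two vectors of `ℝ²`, in coordinates for which the product of the area
forms is the scalar product of `ℝ⁴₂`. -/
def tens (f₁ f₂ g₁ g₂ : ℝ) : V4 :=
  ![(f₂ * g₂ - f₁ * g₁) / 2, (f₁ * g₁ + f₂ * g₂) / 2, (f₂ * g₁ + f₁ * g₂) / 2,
    (f₂ * g₁ - f₁ * g₂) / 2]

lemma ip_tens (f₁ f₂ g₁ g₂ h₁ h₂ k₁ k₂ : ℝ) : ip (tens f₁ f₂ g₁ g₂) (tens h₁ h₂ k₁ k₂) =
    (f₁ * h₂ - f₂ * h₁) * (g₁ * k₂ - g₂ * k₁) / 2 := by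
  simp [ip, tens]; ring

lemma contDiffAt_tens {f₁ f₂ g₁ g₂ : ℝ → ℝ} {s : ℝ} (hf₁ : ContDiffAt ℝ ∞ f₁ s)
    (hf₂ : ContDiffAt ℝ ∞ f₂ s) (hg₁ : ContDiffAt ℝ ∞ g₁ s) (hg₂ : ContDiffAt ℝ ∞ g₂ s) :
    ContDiffAt ℝ ∞ (fun s => tens (f₁ s) (f₂ s) (g₁ s) (g₂ s)) s := by
  refine contDiffAt_pi.2 fun i => ?_
  fin_cases i
  · exact ((hf₂.mul hg₂).sub (hf₁.mul hg₁)).div_const 2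
  · exact ((hf₁.mul hg₁).add (hf₂.mul hg₂)).div_const 2
  · exact ((hf₂.mul hg₁).add (hf₁.mul hg₂)).div_const 2
  · exact ((hf₂.mul hg₁).sub (hf₁.mul hg₂)).div_const 2

lemma hasDerivAt_tens {f₁ f₂ g₁ g₂ : ℝ → ℝ} {s f₁' f₂' g₁' g₂' : ℝ} (hf₁ : HasDerivAt f₁ f₁' s)
    (hf₂ : HasDerivAt f₂ f₂' s) (hg₁ : HasDerivAt g₁ g₁' s) (hg₂ : HasDerivAt g₂ g₂' s) :
    HasDerivAt (fun s => tens (f₁ s) (f₂ s) (g₁ s) (g₂ s))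
      (tens f₁' f₂' (g₁ s) (g₂ s) + tens (f₁ s) (f₂ s) g₁' g₂') s := by
  refine hasDerivAt_pi.2 fun i => ?_
  fin_cases i
  · convert! ((hf₂.mul hg₂).sub (hf₁.mul hg₁)).div_const 2 using 1
    simp [tens]; ring
  · convert! ((hf₁.mul hg₁).add (hf₂.mul hg₂)).div_const 2 using 1
    simp [tens]; ring
  · convert! ((hf₂.mul hg₁).add (hf₁.mul hg₂)).div_const 2 using 1
    simp [tens]; ring
  · convert! ((hf₂.mul hg₁).sub (hf₁.mul hg₂)).div_const 2 using 1
    simp [tens]; ring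

lemma ip_tens_mul_sub (f₁ f₂ g₁ g₂ f₁' f₂' g₁' g₂' h₁ h₂ k₁ k₂ h₁' h₂' k₁' k₂' : ℝ) :
    ip (tens f₁ f₂ g₂ g₁) (tens h₁ h₂ k₂ k₁) *
        ip (tens f₁' f₂' g₂ g₁ + tens f₁ f₂ g₂' g₁') (tens h₁' h₂' k₂ k₁ + tens h₁ h₂ k₂' k₁') -
      ip (tens f₁' f₂' g₂ g₁ + tens f₁ f₂ g₂' g₁') (tens h₁ h₂ k₂ k₁) *
        ip (tens f₁ f₂ g₂ g₁) (tens h₁' h₂' k₂ k₁ + tens h₁ h₂ k₂' k₁') =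
    ((g₁ * k₂ - g₂ * k₁) ^ 2 * (f₁ * f₂' - f₂ * f₁') * (h₁ * h₂' - h₂ * h₁') +
      (f₁ * h₂ - f₂ * h₁) ^ 2 * (g₁ * g₂' - g₂ * g₁') * (k₁ * k₂' - k₂ * k₁')) / 4 := by
  simp only [ip_add_left, ip_add_right, ip_tens]
  ring

lemma det4_tens (f₁ f₂ g₁ g₂ f₁' f₂' g₁' g₂' h₁ h₂ k₁ k₂ h₁' h₂' k₁' k₂' : ℝ) :
    det4 (tens f₁ f₂ g₂ g₁) (tens h₁ h₂ k₂ k₁) (tens f₁' f₂' g₂ g₁ + tens f₁ f₂ g₂' g₁')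
      (tens h₁' h₂' k₂ k₁ + tens h₁ h₂ k₂' k₁') =
    ((f₁ * h₂ - f₂ * h₁) ^ 2 * (g₁ * g₂' - g₂ * g₁') * (k₁ * k₂' - k₂ * k₁') -
      (g₁ * k₂ - g₂ * k₁) ^ 2 * (f₁ * f₂' - f₂ * f₁') * (h₁ * h₂' - h₂ * h₁')) / 4 := by
  simp [det4_eq, minor, tens]
  ring

lemma exists_primitive {c r : ℝ} {a : ℝ → V4} (ha : ∀ s ∈ Metric.ball c r, ContDiffAt ℝ ∞ a s) :
    ∃ α : ℝ → V4, (∀ s ∈ Metric.ball c r, HasDerivAt α (a s) s) ∧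
      ∀ s ∈ Metric.ball c r, ContDiffAt ℝ ∞ α s := by
  have hc : ContinuousOn a (Metric.ball c r) := fun s hs =>
    (ha s hs).continuousAt.continuousWithinAt
  have hd : ∀ s ∈ Metric.ball c r, HasDerivAt (fun s => ∫ y in c..s, a y) (a s) s := fun s hs => by
    have hcr : c ∈ Metric.ball c r := Metric.mem_ball_self (Metric.pos_of_mem_ball hs)
    refine intervalIntegral.integral_hasDerivAt_right ?_
      (hc.stronglyMeasurableAtFilter Metric.isOpen_ball s hs) (ha s hs).continuousAt
    refine (hc.mono ?_).intervalIntegrable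
    exact (convex_ball c r).ordConnected.uIcc_subset hcr hs
  refine ⟨_, hd, fun s hs => ?_⟩
  refine ContDiffOn.contDiffAt ?_ (Metric.isOpen_ball.mem_nhds hs)
  rw [contDiffOn_infty_iff_deriv_of_isOpen Metric.isOpen_ball]
  refine ⟨fun s hs => (hd s hs).differentiableAt.differentiableWithinAt, ?_⟩
  exact ContDiffOn.congr (fun s hs => (ha s hs).contDiffWithinAt) fun s hs => (hd s hs).deriv

end Construction

section NullChange

/-- The point of the parameter plane with given null coordinates. -/
def ofNull : ℝ × ℝ →L[ℝ] ℝ × ℝ :=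
  ((1 / 2 : ℝ) • (ContinuousLinearMap.fst ℝ ℝ ℝ + ContinuousLinearMap.snd ℝ ℝ ℝ)).prod
    ((1 / 2 : ℝ) • (ContinuousLinearMap.fst ℝ ℝ ℝ - ContinuousLinearMap.snd ℝ ℝ ℝ))

/-- The null coordinates of a point of the parameter plane. -/
def toNull : ℝ × ℝ →L[ℝ] ℝ × ℝ :=
  (ContinuousLinearMap.fst ℝ ℝ ℝ + ContinuousLinearMap.snd ℝ ℝ ℝ).prod
    (ContinuousLinearMap.fst ℝ ℝ ℝ - ContinuousLinearMap.snd ℝ ℝ ℝ)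

lemma ofNull_toNull (p : ℝ × ℝ) : ofNull (toNull p) = p := by
  ext <;> simp [ofNull, toNull] <;> ring

lemma ofNull_fst : ofNull (1, 0) = es := by ext <;> norm_num [ofNull, es]

lemma ofNull_snd : ofNull (0, 1) = et := by ext <;> norm_num [ofNull, et]

lemma toNull_es : toNull es = (1, 0) := by ext <;> norm_num [toNull, es]

lemma toNull_et : toNull et = (0, 1) := by ext <;> norm_num [toNull, et]

variable {E : Type*} [NormedAddCommGroup E] [NormedSpace ℝ E]

lemma dd_comp_ofNull {g : ℝ × ℝ → E} {z : ℝ × ℝ} (hg : DifferentiableAt ℝ g (ofNull z))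
    (e : ℝ × ℝ) : dd e (fun z => g (ofNull z)) z = dd (ofNull e) g (ofNull z) := by
  have := hg.hasFDerivAt.comp z ofNull.hasFDerivAt
  rw [dd, HasFDerivAt.fderiv (f := fun z => g (ofNull z)) this]
  rfl

lemma dd_fst_toNull {α : ℝ → E} {α' : E} {p : ℝ × ℝ} (h : HasDerivAt α α' (toNull p).1)
    (e : ℝ × ℝ) : dd e (fun p => α (toNull p).1) p = (toNull e).1 • α' := by
  have h1 : HasFDerivAt (fun p => (toNull p).1) _ p :=
    ((ContinuousLinearMap.fst ℝ ℝ ℝ).comp toNull).hasFDerivAt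
  rw [dd, HasFDerivAt.fderiv (f := fun p => α (toNull p).1) (h.hasFDerivAt.comp p h1)]
  rfl

lemma dd_snd_toNull {β : ℝ → E} {β' : E} {p : ℝ × ℝ} (h : HasDerivAt β β' (toNull p).2)
    (e : ℝ × ℝ) : dd e (fun p => β (toNull p).2) p = (toNull e).2 • β' := by
  have h1 : HasFDerivAt (fun p => (toNull p).2) _ p :=
    ((ContinuousLinearMap.snd ℝ ℝ ℝ).comp toNull).hasFDerivAt
  rw [dd, HasFDerivAt.fderiv (f := fun p => β (toNull p).2) (h.hasFDerivAt.comp p h1)]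
  rfl

end NullChange

section Realization

/-- A translation surface with prescribed null derivatives. -/
lemma exists_translationSurface {z : ℝ × ℝ} {r : ℝ} {a b : ℝ → V4}
    (ha : ∀ s ∈ Metric.ball z.1 r, ContDiffAt ℝ ∞ a s)
    (hb : ∀ t ∈ Metric.ball z.2 r, ContDiffAt ℝ ∞ b t) :
    ∃ x : ℝ × ℝ → V4, ∀ p ∈ toNull ⁻¹' Metric.ball z r, ContDiffAt ℝ ∞ x p ∧
      dd es x p = a (toNull p).1 ∧ dd et x p = b (toNull p).2 ∧
      dd es (dd es x) p = deriv a (toNull p).1 ∧ dd et (dd et x) p = deriv b (toNull p).2 ∧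
      dd et (dd es x) p = 0 := by
  obtain ⟨α, hα, cα⟩ := exists_primitive ha
  obtain ⟨β, hβ, cβ⟩ := exists_primitive hb
  have hU : IsOpen (toNull ⁻¹' Metric.ball z r) := Metric.isOpen_ball.preimage toNull.continuous
  have m1 : ∀ p ∈ toNull ⁻¹' Metric.ball z r, (toNull p).1 ∈ Metric.ball z.1 r := fun p hp => by
    have : toNull p ∈ Metric.ball z r := hp
    rw [← ball_prod_same] at this; exact this.1
  have m2 : ∀ p ∈ toNull ⁻¹' Metric.ball z r, (toNull p).2 ∈ Metric.ball z.2 r := fun p hp => by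
    have : toNull p ∈ Metric.ball z r := hp
    rw [← ball_prod_same] at this; exact this.2
  have c1 : ∀ p ∈ toNull ⁻¹' Metric.ball z r, ContDiffAt ℝ ∞ (fun p => α (toNull p).1) p :=
    fun p hp => (cα _ (m1 p hp)).comp p toNull.contDiff.fst.contDiffAt
  have c2 : ∀ p ∈ toNull ⁻¹' Metric.ball z r, ContDiffAt ℝ ∞ (fun p => β (toNull p).2) p :=
    fun p hp => (cβ _ (m2 p hp)).comp p toNull.contDiff.snd.contDiffAt
  have d1 : ∀ p ∈ toNull ⁻¹' Metric.ball z r,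
      dd es (fun p => α (toNull p).1 + β (toNull p).2) p = a (toNull p).1 := fun p hp => by
    rw [dd_add es (smooth_differentiableAt (c1 p hp)) (smooth_differentiableAt (c2 p hp)),
      dd_fst_toNull (hα _ (m1 p hp)), dd_snd_toNull (hβ _ (m2 p hp)), toNull_es]
    simp
  have d2 : ∀ p ∈ toNull ⁻¹' Metric.ball z r,
      dd et (fun p => α (toNull p).1 + β (toNull p).2) p = b (toNull p).2 := fun p hp => by
    rw [dd_add et (smooth_differentiableAt (c1 p hp)) (smooth_differentiableAt (c2 p hp)),
      dd_fst_toNull (hα _ (m1 p hp)), dd_snd_toNull (hβ _ (m2 p hp)), toNull_et]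
    simp
  refine ⟨fun p => α (toNull p).1 + β (toNull p).2, fun p hp =>
    ⟨(c1 p hp).add (c2 p hp), d1 p hp, d2 p hp, ?_, ?_, ?_⟩⟩
  · rw [dd_congr hU d1 es hp,
      dd_fst_toNull (smooth_differentiableAt (ha _ (m1 p hp))).hasDerivAt, toNull_es, one_smul]
  · rw [dd_congr hU d2 et hp,
      dd_snd_toNull (smooth_differentiableAt (hb _ (m2 p hp))).hasDerivAt, toNull_et, one_smul]
  · rw [dd_congr hU d1 et hp,
      dd_fst_toNull (smooth_differentiableAt (ha _ (m1 p hp))).hasDerivAt, toNull_et, zero_smul]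

theorem exists_goodSurf {z : ℝ × ℝ} {r σ : ℝ} (hσ : σ ^ 2 = 1) {F G : ℝ × ℝ → ℝ}
    {f₁ f₂ g₁ g₂ h₁ h₂ k₁ k₂ : ℝ → ℝ} (W : WedgeDecomposition z r σ F f₁ f₂ h₁ h₂)
    (W' : WedgeDecomposition z r σ G g₁ g₂ k₁ k₂) (hF : ∀ p ∈ Metric.ball z r, 0 < F p)
    (hG : ∀ p ∈ Metric.ball z r, 0 < G p) :
    ∃ x : ℝ × ℝ → V4, GoodSurf (toNull ⁻¹' Metric.ball z r) x ∧
      ∀ p ∈ toNull ⁻¹' Metric.ball z r,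
        GaussK x p = σ / 2 * (F (toNull p) ^ 2 + G (toNull p) ^ 2) /
          (F (toNull p) * G (toNull p)) ^ 3 ∧
        NormK x p = σ / 2 * (F (toNull p) ^ 2 - G (toNull p) ^ 2) /
          (F (toNull p) * G (toNull p)) ^ 3 := by
  obtain ⟨x, hx⟩ := exists_translationSurface (z := z) (r := r)
    (a := fun s => tens (f₁ s) (f₂ s) (g₂ s) (g₁ s)) (b := fun t => tens (h₁ t) (h₂ t) (k₂ t) (k₁ t))
    (fun s hs => contDiffAt_tens (W.smooth_f₁ s hs) (W.smooth_f₂ s hs) (W'.smooth_f₂ s hs)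
      (W'.smooth_f₁ s hs))
    (fun t ht => contDiffAt_tens (W.smooth_h₁ t ht) (W.smooth_h₂ t ht) (W'.smooth_h₂ t ht)
      (W'.smooth_h₁ t ht))
  have m : ∀ p ∈ toNull ⁻¹' Metric.ball z r,
      (toNull p).1 ∈ Metric.ball z.1 r ∧ (toNull p).2 ∈ Metric.ball z.2 r := fun p hp => by
    have : toNull p ∈ Metric.ball z r := hp
    rwa [← ball_prod_same] at this
  have da : ∀ s ∈ Metric.ball z.1 r, deriv (fun s => tens (f₁ s) (f₂ s) (g₂ s) (g₁ s)) s =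
      tens (deriv f₁ s) (deriv f₂ s) (g₂ s) (g₁ s) +
        tens (f₁ s) (f₂ s) (deriv g₂ s) (deriv g₁ s) := fun s hs =>
    (hasDerivAt_tens (smooth_differentiableAt (W.smooth_f₁ s hs)).hasDerivAt
      (smooth_differentiableAt (W.smooth_f₂ s hs)).hasDerivAt
      (smooth_differentiableAt (W'.smooth_f₂ s hs)).hasDerivAt
      (smooth_differentiableAt (W'.smooth_f₁ s hs)).hasDerivAt).deriv
  have db : ∀ t ∈ Metric.ball z.2 r, deriv (fun t => tens (h₁ t) (h₂ t) (k₂ t) (k₁ t)) t =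
      tens (deriv h₁ t) (deriv h₂ t) (k₂ t) (k₁ t) +
        tens (h₁ t) (h₂ t) (deriv k₂ t) (deriv k₁ t) := fun t ht =>
    (hasDerivAt_tens (smooth_differentiableAt (W.smooth_h₁ t ht)).hasDerivAt
      (smooth_differentiableAt (W.smooth_h₂ t ht)).hasDerivAt
      (smooth_differentiableAt (W'.smooth_h₂ t ht)).hasDerivAt
      (smooth_differentiableAt (W'.smooth_h₁ t ht)).hasDerivAt).deriv
  have hP : ∀ p ∈ toNull ⁻¹' Metric.ball z r,
      ip (dd es x p) (dd et x p) = -(F (toNull p) * G (toNull p)) / 2 := fun p hp => by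
    obtain ⟨-, h1, h2, -⟩ := hx p hp
    have w := W.wedge _ (m p hp).1 _ (m p hp).2
    have w' := W'.wedge _ (m p hp).1 _ (m p hp).2
    rw [h1, h2, ip_tens, w]
    linear_combination -F (toNull p) / 2 * w'
  have hN : NullData (toNull ⁻¹' Metric.ball z r) x := by
    constructor <;> intro p hp <;> obtain ⟨c, h1, h2, h3, h4, h5⟩ := hx p hp <;>
      obtain ⟨m1, m2⟩ := m p hp
    · exact c
    · exact h5
    · rw [h1, ip_tens]; ring
    · rw [h2, ip_tens]; ring
    · rw [hP p hp]
      have := mul_pos (hF _ hp) (hG _ hp)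
      linarith
    · rw [h3, h1, da _ m1]; simp only [ip_add_left, ip_tens]; ring
    · rw [h4, h2, db _ m2]; simp only [ip_add_left, ip_tens]; ring
    · rw [h3, da _ m1]; simp only [ip_add_left, ip_add_right, ip_tens]
      have e1 := W.wronskian_f _ m1
      have e2 := W'.wronskian_f _ m1
      linear_combination (g₁ (toNull p).1 * deriv g₂ (toNull p).1 -
        g₂ (toNull p).1 * deriv g₁ (toNull p).1) * e1 + 1 / 2 * e2
    · rw [h4, db _ m2]; simp only [ip_add_left, ip_add_right, ip_tens]
      have e1 := W.wronskian_h _ m2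
      have e2 := W'.wronskian_h _ m2
      linear_combination (k₁ (toNull p).2 * deriv k₂ (toNull p).2 -
        k₂ (toNull p).2 * deriv k₁ (toNull p).2) * e1 + σ / 2 * e2 + 1 / 4 * hσ
  refine ⟨x, hN.goodSurf, fun p hp => ?_⟩
  have hP0 : ip (dd es x p) (dd et x p) ≠ 0 := (hN.neg p hp).ne
  have hF0 := (hF _ hp).ne'
  have hG0 := (hG _ hp).ne'
  obtain ⟨m1, m2⟩ := m p hp
  obtain ⟨-, h1, h2, h3, h4, -⟩ := hx p hp
  have w := W.wedge _ m1 _ m2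
  have w' := W'.wedge _ m1 _ m2
  have e1 := W.wronskian_f _ m1
  have e2 := W'.wronskian_f _ m1
  have e3 := W.wronskian_h _ m2
  have e4 := W'.wronskian_h _ m2
  rw [Prod.mk.eta] at w w'
  have q1 : ip (dd es x p) (dd et x p) * ip (dd es (dd es x) p) (dd et (dd et x) p) -
      ip (dd es (dd es x) p) (dd et x p) * ip (dd es x p) (dd et (dd et x) p) =
      σ / 16 * (F (toNull p) ^ 2 + G (toNull p) ^ 2) := by
    rw [h1, h2, h3, h4, da _ m1, db _ m2]
    rw [ip_tens_mul_sub, w, w', mul_assoc, mul_assoc, e1, e2, e3, e4]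
    ring
  have q2 : det4 (dd es x p) (dd et x p) (dd es (dd es x) p) (dd et (dd et x) p) =
      σ / 16 * (F (toNull p) ^ 2 - G (toNull p) ^ 2) := by
    rw [h1, h2, h3, h4, da _ m1, db _ m2]
    rw [det4_tens, w, w', e1, e2, e3, e4]
    ring
  have hm := hN.minimal p hp
  have hE := Ef_eq (hN.aa p hp) (hN.bb p hp)
  rw [GaussK_eq (hN.smooth p hp) hm (hN.aa p hp) (hN.bb p hp) (hN.ha p hp) (hN.hb p hp),
    NormK_eq (hN.smooth p hp) hm (hN.aa p hp) (hN.bb p hp) (hN.ha p hp) (hN.hb p hp), hE,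
    ip_nullNormal_nullNormal hP0, det4_nullNormal, q2]
  have q3 : ip (dd es (dd es x) p) (dd et (dd et x) p) -
      ip (dd es (dd es x) p) (dd et x p) * ip (dd es x p) (dd et (dd et x) p) /
        ip (dd es x p) (dd et x p) =
      σ / 16 * (F (toNull p) ^ 2 + G (toNull p) ^ 2) / ip (dd es x p) (dd et x p) := by
    rw [← q1]; field_simp
  rw [q3, hP p hp]
  constructor
  · field_simp; ring
  · field_simp; ring

end Realization

section NaturalEquations

lemma exists_wedgeDecomposition_of_liouville {D : Set (ℝ × ℝ)} (hD : IsOpen D) {X : ℝ × ℝ → ℝ}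
    {σ : ℝ} (hX : ∀ p ∈ D, ContDiffAt ℝ ∞ X p)
    (hL : ∀ p ∈ D, dd es (dd et X) p = σ / 2 * Real.exp (-X p)) (hσ : σ ^ 2 = 1) {z : ℝ × ℝ} {r : ℝ}
    (hr : 0 < r) (hz : ∀ y ∈ Metric.ball z r, ofNull y ∈ D) :
    ∃ f₁ f₂ h₁ h₂ : ℝ → ℝ,
      WedgeDecomposition z r σ (fun y => Real.exp (X (ofNull y) / 2)) f₁ f₂ h₁ h₂ := by
  have hF : ∀ p ∈ D, ContDiffAt ℝ ∞ (fun q => Real.exp (X q / 2)) p := fun p hp =>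
    ((hX p hp).div_const 2).exp
  have h1 (e : ℝ × ℝ) : ∀ y ∈ Metric.ball z r, dd e (fun y => Real.exp (X (ofNull y) / 2)) y =
      dd (ofNull e) (fun q => Real.exp (X q / 2)) (ofNull y) := fun y hy =>
    dd_comp_ofNull (g := fun q => Real.exp (X q / 2)) (smooth_differentiableAt (hF _ (hz y hy))) e
  refine exists_wedgeDecomposition hr hσ
    (fun y hy => (hF _ (hz y hy)).comp y ofNull.contDiff.contDiffAt)
    (fun y _ => (Real.exp_pos _).ne') fun y hy => ?_
  rw [dd_congr Metric.isOpen_ball (h1 (0, 1)) _ hy, dd_comp_ofNull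
    (smooth_differentiableAt (contDiffAt_dd (hF _ (hz y hy)) _)), h1 _ y hy, h1 _ y hy,
    ofNull_fst, ofNull_snd]
  exact liouville_bilinear hD hX hL (hz y hy)

lemma dd_dd_comb (e e' : ℝ × ℝ) {D : Set (ℝ × ℝ)} (hD : IsOpen D) {P Q : ℝ × ℝ → ℝ}
    (hP : ∀ p ∈ D, ContDiffAt ℝ ∞ P p) (hQ : ∀ p ∈ D, ContDiffAt ℝ ∞ Q p) (c d : ℝ)
    {p : ℝ × ℝ} (hp : p ∈ D) : dd e (dd e' fun q => c * P q + d * Q q) p =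
      c * dd e (dd e' P) p + d * dd e (dd e' Q) p := by
  have key {P Q : ℝ × ℝ → ℝ} {p e : ℝ × ℝ} (hP : DifferentiableAt ℝ P p)
      (hQ : DifferentiableAt ℝ Q p) :
      dd e (fun q => c * P q + d * Q q) p = c * dd e P p + d * dd e Q p := by
    rw [dd_add e (hP.const_mul c) (hQ.const_mul d), dd_mul e (differentiableAt_const c) hP,
      dd_mul e (differentiableAt_const d) hQ, dd_const, dd_const]
    ring
  rw [dd_congr hD (fun q hq => key (smooth_differentiableAt (hP q hq))
    (smooth_differentiableAt (hQ q hq))) e hp]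
  exact key (smooth_differentiableAt (contDiffAt_dd (hP p hp) e'))
    (smooth_differentiableAt (contDiffAt_dd (hQ p hp) e'))

lemma hlap_eq_of_eqOn {D : Set (ℝ × ℝ)} (hD : IsOpen D) {f g : ℝ × ℝ → ℝ}
    (h : ∀ p ∈ D, f p = g p) {p : ℝ × ℝ} (hp : p ∈ D) (hg : ContDiffAt ℝ ∞ g p) :
    hlap f p = 4 * dd es (dd et g) p := by
  have h1 : hlap f p = hlap g p := congrArg₂ (fun a b : ℝ => a - b)
    (dd_congr hD (fun q hq => dd_congr hD h (1, 0) hq) (1, 0) hp)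
    (dd_congr hD (fun q hq => dd_congr hD h (0, 1) hq) (0, 1) hp)
  rw [h1, hlap, pu_pu_sub_pv_pv hg, dd_comm hg, smul_eq_mul]

/-- The natural equations split into two Liouville equations. -/
lemma liouville_of_natural {w σ P Q LP LQ : ℝ} (hw : w = Real.exp ((P + Q) / 4))
    (h₁ : w * (4 * (1 * LP + 1 * LQ)) = -8 * (σ * (Real.exp P + Real.exp Q) / 2))
    (h₂ : w * (4 * (1 * LP + -1 * LQ)) = -4 * (σ * (Real.exp P - Real.exp Q) / 2)) :
    1 / 4 * LP + -3 / 4 * LQ = σ / 2 * Real.exp (-(1 / 4 * P + -3 / 4 * Q)) ∧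
      -3 / 4 * LP + 1 / 4 * LQ = σ / 2 * Real.exp (-(-3 / 4 * P + 1 / 4 * Q)) := by
  have hw0 : w ≠ 0 := hw ▸ (Real.exp_pos _).ne'
  have hX : w * Real.exp (-(1 / 4 * P + -3 / 4 * Q)) = Real.exp Q := by
    rw [hw, ← Real.exp_add]; ring_nf
  have hY : w * Real.exp (-(-3 / 4 * P + 1 / 4 * Q)) = Real.exp P := by
    rw [hw, ← Real.exp_add]; ring_nf
  constructor <;> refine mul_left_cancel₀ hw0 ?_
  · linear_combination -1 / 16 * h₁ + 1 / 8 * h₂ - σ / 2 * hX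
  · linear_combination -1 / 16 * h₁ - 1 / 8 * h₂ - σ / 2 * hY

theorem exists_of_natural {D : Set (ℝ × ℝ)} (hD : IsOpen D) {σ : ℝ} (hσ : σ ^ 2 = 1)
    {K κ P Q : ℝ × ℝ → ℝ} (hP : ∀ p ∈ D, ContDiffAt ℝ ∞ P p) (hQ : ∀ p ∈ D, ContDiffAt ℝ ∞ Q p)
    (hKP : ∀ p ∈ D, K p + κ p = σ * Real.exp (P p)) (hKQ : ∀ p ∈ D, K p - κ p = σ * Real.exp (Q p))
    (heq1 : ∀ p ∈ D, |K p ^ 2 - κ p ^ 2| ^ ((1 : ℝ) / 4) *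
      hlap (fun s => Real.log |K s ^ 2 - κ s ^ 2|) p = -8 * K p)
    (heq2 : ∀ p ∈ D, |K p ^ 2 - κ p ^ 2| ^ ((1 : ℝ) / 4) *
      hlap (fun s => Real.log |(K s + κ s) / (K s - κ s)|) p = -4 * κ p) {t₀ : ℝ × ℝ} (ht : t₀ ∈ D) :
    ∃ D₀ : Set (ℝ × ℝ), IsOpen D₀ ∧ t₀ ∈ D₀ ∧ D₀ ⊆ D ∧
      ∃ x : ℝ × ℝ → V4, GoodSurf D₀ x ∧ ∀ p ∈ D₀, GaussK x p = K p ∧ NormK x p = κ p := by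
  have hprod : ∀ p ∈ D, K p ^ 2 - κ p ^ 2 = Real.exp (P p + Q p) := fun p hp => by
    rw [Real.exp_add]
    linear_combination (K p - κ p) * hKP p hp + σ * Real.exp (P p) * hKQ p hp +
      Real.exp (P p) * Real.exp (Q p) * hσ
  have hσ0 : σ ≠ 0 := by rintro rfl; norm_num at hσ
  have hsum : ∀ p ∈ D, Real.log |K p ^ 2 - κ p ^ 2| = 1 * P p + 1 * Q p := fun p hp => by
    rw [hprod p hp, Real.log_abs, Real.log_exp]; ring
  have hdiff : ∀ p ∈ D, Real.log |(K p + κ p) / (K p - κ p)| = 1 * P p + -1 * Q p := fun p hp => by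
    rw [hKP p hp, hKQ p hp, mul_div_mul_left _ _ hσ0, ← Real.exp_sub, Real.log_abs, Real.log_exp]
    ring
  have hw : ∀ p ∈ D, |K p ^ 2 - κ p ^ 2| ^ ((1 : ℝ) / 4) = Real.exp ((P p + Q p) / 4) :=
    fun p hp => by
      rw [hprod p hp, abs_of_pos (Real.exp_pos _), ← Real.exp_mul]; ring_nf
  have comb (c d : ℝ) : ∀ p ∈ D, ContDiffAt ℝ ∞ (fun q => c * P q + d * Q q) p := fun p hp =>
    (contDiffAt_const.mul (hP p hp)).add (contDiffAt_const.mul (hQ p hp))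
  have hL : ∀ p ∈ D, _ ∧ _ := fun p hp => liouville_of_natural (σ := σ) (hw p hp)
    (LP := dd es (dd et P) p) (LQ := dd es (dd et Q) p)
    (by
      rw [← dd_dd_comb es et hD hP hQ 1 1 hp, ← hlap_eq_of_eqOn hD hsum hp (comb 1 1 p hp),
        heq1 p hp]
      linear_combination -4 * (hKP p hp + hKQ p hp))
    (by
      rw [← dd_dd_comb es et hD hP hQ 1 (-1) hp, ← hlap_eq_of_eqOn hD hdiff hp (comb 1 (-1) p hp),
        heq2 p hp]
      linear_combination -2 * (hKP p hp - hKQ p hp))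
  have hO : IsOpen (ofNull ⁻¹' D) := hD.preimage ofNull.continuous
  obtain ⟨r, hr, hz⟩ := Metric.isOpen_iff.1 hO (toNull t₀)
    (by rw [Set.mem_preimage, ofNull_toNull]; exact ht)
  obtain ⟨f₁, f₂, h₁, h₂, W⟩ := exists_wedgeDecomposition_of_liouville hD (comb (1 / 4) (-3 / 4))
    (fun p hp => (dd_dd_comb es et hD hP hQ _ _ hp).trans (hL p hp).1) hσ hr (fun y hy => hz hy)
  obtain ⟨g₁, g₂, k₁, k₂, W'⟩ := exists_wedgeDecomposition_of_liouville hD (comb (-3 / 4) (1 / 4))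
    (fun p hp => (dd_dd_comb es et hD hP hQ _ _ hp).trans (hL p hp).2) hσ hr (fun y hy => hz hy)
  obtain ⟨x, hx, hc⟩ := exists_goodSurf hσ W W' (fun _ _ => Real.exp_pos _)
    (fun _ _ => Real.exp_pos _)
  have hsub : toNull ⁻¹' Metric.ball (toNull t₀) r ⊆ D := fun p hp => by
    have := hz hp
    rwa [Set.mem_preimage, ofNull_toNull] at this
  refine ⟨_, Metric.isOpen_ball.preimage toNull.continuous, Metric.mem_ball_self hr, hsub, x, hx,
    fun p hp => ?_⟩
  have hF : Real.exp ((1 / 4 * P p + -3 / 4 * Q p) / 2) ^ 2 =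
      Real.exp (P p) * (Real.exp ((1 / 4 * P p + -3 / 4 * Q p) / 2) *
        Real.exp ((-3 / 4 * P p + 1 / 4 * Q p) / 2)) ^ 3 := by
    rw [← Real.exp_add, ← Real.exp_nat_mul, ← Real.exp_nat_mul, ← Real.exp_add]
    push_cast; ring_nf
  have hG : Real.exp ((-3 / 4 * P p + 1 / 4 * Q p) / 2) ^ 2 =
      Real.exp (Q p) * (Real.exp ((1 / 4 * P p + -3 / 4 * Q p) / 2) *
        Real.exp ((-3 / 4 * P p + 1 / 4 * Q p) / 2)) ^ 3 := by
    rw [← Real.exp_add, ← Real.exp_nat_mul, ← Real.exp_nat_mul, ← Real.exp_add]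
    push_cast; ring_nf
  have h0 : (Real.exp ((1 / 4 * P p + -3 / 4 * Q p) / 2) *
        Real.exp ((-3 / 4 * P p + 1 / 4 * Q p) / 2)) ^ 3 ≠ 0 := by positivity
  have e1 := hKP p (hsub hp)
  have e2 := hKQ p (hsub hp)
  obtain ⟨c1, c2⟩ := hc p hp
  simp only [ofNull_toNull] at c1 c2
  rw [c1, c2, div_eq_iff h0, div_eq_iff h0, hF, hG]
  constructor
  · linear_combination -(Real.exp ((1 / 4 * P p + -3 / 4 * Q p) / 2) *
        Real.exp ((-3 / 4 * P p + 1 / 4 * Q p) / 2)) ^ 3 / 2 * (e1 + e2)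
  · linear_combination -(Real.exp ((1 / 4 * P p + -3 / 4 * Q p) / 2) *
        Real.exp ((-3 / 4 * P p + 1 / 4 * Q p) / 2)) ^ 3 / 2 * (e1 - e2)

end NaturalEquations

/-- Bonnet-type theorem, first type. Any solution (K, ϰ) of the system of
natural equations with K p ^ 2 - κ p ^ 2 > 0 is locally realized by a unique (up to a proper motion of
ℝ⁴₂) minimal time-like surface of the first type in canonical coordinates. -/
theorem stmt_14 (D : Set (ℝ × ℝ)) (hD : IsOpen D) (K κ : ℝ × ℝ → ℝ)
    (hK : ContDiffOn ℝ (⊤ : ℕ∞) K D) (hκ : ContDiffOn ℝ (⊤ : ℕ∞) κ D)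
    (hsign : ∀ p ∈ D, K p ^ 2 - κ p ^ 2 > 0)
    (heq1 : ∀ p ∈ D, |K p ^ 2 - κ p ^ 2| ^ ((1 : ℝ) / 4) *
      hlap (fun s => Real.log |K s ^ 2 - κ s ^ 2|) p = -8 * K p)
    (heq2 : ∀ p ∈ D, |K p ^ 2 - κ p ^ 2| ^ ((1 : ℝ) / 4) *
      hlap (fun s => Real.log |(K s + κ s) / (K s - κ s)|) p = -4 * κ p) :
    ∀ t₀ ∈ D,
      (∃ D₀ : Set (ℝ × ℝ), IsOpen D₀ ∧ t₀ ∈ D₀ ∧ D₀ ⊆ D ∧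
        ∃ x : ℝ × ℝ → V4, GoodSurf D₀ x ∧
          ∀ p ∈ D₀, GaussK x p = K p ∧ NormK x p = κ p) ∧
      (∀ (D₁ D₂ : Set (ℝ × ℝ)) (x₁ x₂ : ℝ × ℝ → V4),
        IsOpen D₁ → t₀ ∈ D₁ → D₁ ⊆ D → GoodSurf D₁ x₁ →
        (∀ p ∈ D₁, GaussK x₁ p = K p ∧ NormK x₁ p = κ p) →
        IsOpen D₂ → t₀ ∈ D₂ → D₂ ⊆ D → GoodSurf D₂ x₂ →
        (∀ p ∈ D₂, GaussK x₂ p = K p ∧ NormK x₂ p = κ p) →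
        ∃ (D₃ : Set (ℝ × ℝ)) (A : V4 →ₗ[ℝ] V4) (c : V4),
          IsOpen D₃ ∧ t₀ ∈ D₃ ∧ D₃ ⊆ D₁ ∩ D₂ ∧
          (∀ v w : V4, ip (A v) (A w) = ip v w) ∧ LinearMap.det A = 1 ∧
          ∀ p ∈ D₃, x₂ p = A (x₁ p) + c) := by
  intro t₀ ht₀
  refine ⟨?_, fun D₁ D₂ x₁ x₂ hD₁ ht₁ _ h₁ hc₁ hD₂ ht₂ _ h₂ hc₂ => ?_⟩
  · obtain ⟨σ, hσ, hσK⟩ : ∃ σ : ℝ, σ ^ 2 = 1 ∧ 0 < σ * K t₀ := by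
      have hK0 : K t₀ ≠ 0 := fun h => by nlinarith [hsign t₀ ht₀, sq_nonneg (κ t₀)]
      rcases hK0.lt_or_gt with h | h
      · exact ⟨-1, by norm_num, by linarith⟩
      · exact ⟨1, by norm_num, by linarith⟩
    have hD' : IsOpen (D ∩ {p | 0 < σ * K p}) :=
      (continuousOn_const.mul hK.continuousOn).isOpen_inter_preimage hD isOpen_Ioi
    have hpos : ∀ p ∈ D ∩ {p | 0 < σ * K p}, 0 < σ * (K p + κ p) ∧ 0 < σ * (K p - κ p) := by
      rintro p ⟨hp, hp'⟩
      have h1 := hsign p hp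
      have h2 : 0 < σ * K p := hp'
      have h3 : |σ * κ p| < σ * K p :=
        abs_lt_of_sq_lt_sq (by rw [mul_pow, mul_pow, hσ]; linarith) h2.le
      obtain ⟨h4, h5⟩ := abs_lt.1 h3
      exact ⟨by linarith, by linarith⟩
    have hKc : ∀ p ∈ D, ContDiffAt ℝ ∞ K p := fun p hp => hK.contDiffAt (hD.mem_nhds hp)
    have hκc : ∀ p ∈ D, ContDiffAt ℝ ∞ κ p := fun p hp => hκ.contDiffAt (hD.mem_nhds hp)
    obtain ⟨D₀, hD₀, ht, hsub, hx⟩ := exists_of_natural hD' hσ (K := K) (κ := κ)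
      (P := fun p => Real.log (σ * (K p + κ p))) (Q := fun p => Real.log (σ * (K p - κ p)))
      (fun p hp => (contDiffAt_const.mul ((hKc p hp.1).add (hκc p hp.1))).log (hpos p hp).1.ne')
      (fun p hp => (contDiffAt_const.mul ((hKc p hp.1).sub (hκc p hp.1))).log (hpos p hp).2.ne')
      (fun p hp => by rw [Real.exp_log (hpos p hp).1]; linear_combination -(K p + κ p) * hσ)
      (fun p hp => by rw [Real.exp_log (hpos p hp).2]; linear_combination -(K p - κ p) * hσ)
      (fun p hp => heq1 p hp.1) (fun p hp => heq2 p hp.1) ⟨ht₀, hσK⟩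
    exact ⟨D₀, hD₀, ht, hsub.trans Set.inter_subset_left, hx⟩
  · exact rigidity (hD₁.inter hD₂) ((h₁.nullData hD₁).mono Set.inter_subset_left)
      ((h₂.nullData hD₂).mono Set.inter_subset_right)
      (fun p hp => (hc₁ p hp.1).1.trans (hc₂ p hp.2).1.symm)
      (fun p hp => (hc₁ p hp.1).2.trans (hc₂ p hp.2).2.symm) ⟨ht₁, ht₂⟩
end
end

section
/- Let D ⊆ ℝ² be open and connected and let g, h : D → ℝ be C² functions satisfying the Cauchy–Riemann equations over the double numbers, h_u = g_v and h_v = g_u, together with g_u² − g_v² = 1 on D. Then there exist θ ∈ ℝ, ς ∈ {1, −1}, and constants c₁, c₂ ∈ ℝ such that g(u,v) = ς·(u·cosh θ + v·sinh θ) + c₁ and h(u,v) = ς·(u·sinh θ + v·cosh θ) + c₂ for all (u,v) ∈ D. (Equivalently: a double-number holomorphic function f = g + jh with |f'|² ≡ 1 has the form f(t) = ±e^{jθ}·t + c.) -/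
noncomputable section

/-- A continuous linear functional on `ℝ × ℝ` is determined by its values on the standard basis. -/
lemma clm_prod_apply {E : Type*} [NormedAddCommGroup E] [NormedSpace ℝ E]
    (L : ℝ × ℝ →L[ℝ] E) (p : ℝ × ℝ) : L p = p.1 • L (1, 0) + p.2 • L (0, 1) := by
  rw [← map_smul, ← map_smul, ← map_add]
  simp

/-- For a double-number holomorphic `g + jh` with `g_u² - g_v² = 1`, the second derivative
of `g` vanishes. -/
lemma fderiv_fderiv_eq_zero_of_cauchyRiemann {D : Set (ℝ × ℝ)} (hD : IsOpen D)
    {g h : ℝ × ℝ → ℝ} (hg : ContDiffOn ℝ 2 g D) (hh : ContDiffOn ℝ 2 h D)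
    (hCR1 : ∀ p ∈ D, pu h p = pv g p) (hCR2 : ∀ p ∈ D, pv h p = pu g p)
    (hnorm : ∀ p ∈ D, (pu g p) ^ 2 - (pv g p) ^ 2 = 1) {p : ℝ × ℝ} (hp : p ∈ D) :
    fderiv ℝ (fderiv ℝ g) p = 0 := by
  have hnhds : D ∈ nhds p := hD.mem_nhds hp
  have hgp : ContDiffAt ℝ 2 g p := hg.contDiffAt hnhds
  have hhp : ContDiffAt ℝ 2 h p := hh.contDiffAt hnhds
  have hg' : HasFDerivAt (fderiv ℝ g) (fderiv ℝ (fderiv ℝ g) p) p :=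
    ((hgp.fderiv_right (m := 1) (by norm_num)).differentiableAt (by norm_num)).hasFDerivAt
  have hh' : HasFDerivAt (fderiv ℝ h) (fderiv ℝ (fderiv ℝ h) p) p :=
    ((hhp.fderiv_right (m := 1) (by norm_num)).differentiableAt (by norm_num)).hasFDerivAt
  have hgs := hgp.isSymmSndFDerivAt (by simp) (1, 0) (0, 1)
  have hhs := hhp.isSymmSndFDerivAt (by simp) (1, 0) (0, 1)
  set G := fderiv ℝ (fderiv ℝ g) p
  set H := fderiv ℝ (fderiv ℝ h) p
  have hgu := hg'.clm_apply (hasFDerivAt_const ((1, 0) : ℝ × ℝ) p)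
  have hgv := hg'.clm_apply (hasFDerivAt_const ((0, 1) : ℝ × ℝ) p)
  have hhu := hh'.clm_apply (hasFDerivAt_const ((1, 0) : ℝ × ℝ) p)
  have hhv := hh'.clm_apply (hasFDerivAt_const ((0, 1) : ℝ × ℝ) p)
  have h1 := hhu.unique (hgv.congr_of_eventuallyEq (Filter.eventually_of_mem hnhds hCR1))
  have h2 := hhv.unique (hgu.congr_of_eventuallyEq (Filter.eventually_of_mem hnhds hCR2))
  have h3 := ((hgu.pow 2).sub (hgv.pow 2)).unique
    ((hasFDerivAt_const (1 : ℝ) p).congr_of_eventuallyEq (Filter.eventually_of_mem hnhds hnorm))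
  have e1 (w) : H w (1, 0) = G w (0, 1) := by simpa using DFunLike.congr_fun h1 w
  have e2 (w) : H w (0, 1) = G w (1, 0) := by simpa using DFunLike.congr_fun h2 w
  have e3 (w) : pu g p * G w (1, 0) = pv g p * G w (0, 1) := by
    have hw : 2 * pu g p * G w (1, 0) - 2 * pv g p * G w (0, 1) = 0 := by
      simpa [pu, pv] using DFunLike.congr_fun h3 w
    linarith
  have hn := hnorm p hp
  have hx := e3 (1, 0)
  have hy := e3 (0, 1)
  rw [e2, e1] at hhs
  rw [← hhs, ← hgs] at hy
  have huu : G (1, 0) (1, 0) = 0 := by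
    linear_combination (-G (1, 0) (1, 0)) * hn + pu g p * hx + pv g p * hy
  have huv : G (1, 0) (0, 1) = 0 := by
    linear_combination (-G (1, 0) (0, 1)) * hn + pu g p * hy + pv g p * hx
  ext <;> simp [huu, huv, ← hgs, ← hhs]

/-- A function on a connected open set whose partial derivatives are constant is affine. -/
lemma exists_eq_affine_of_partials_eq {D : Set (ℝ × ℝ)} (hD : IsOpen D) (hconn : IsPreconnected D)
    {f : ℝ × ℝ → ℝ} (hf : DifferentiableOn ℝ f D) {a b : ℝ}
    (ha : ∀ p ∈ D, pu f p = a) (hb : ∀ p ∈ D, pv f p = b) :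
    ∃ c, ∀ p ∈ D, f p = p.1 * a + p.2 * b + c := by
  let L : ℝ × ℝ →L[ℝ] ℝ :=
    (ContinuousLinearMap.fst ℝ ℝ ℝ).smulRight a + (ContinuousLinearMap.snd ℝ ℝ ℝ).smulRight b
  obtain ⟨c, hc⟩ := hD.exists_eq_add_of_fderiv_eq hconn hf L.differentiableOn fun p hp ↦ by
    rw [L.fderiv]
    refine ContinuousLinearMap.ext fun w ↦ ?_
    have h1 := ha p hp
    have h2 := hb p hp
    rw [clm_prod_apply]
    simp only [pu, pv] at h1 h2
    simp [L, h1, h2]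
  exact ⟨c, fun p hp ↦ by simpa [L] using hc hp⟩

/-- The unit hyperbola is parametrized by `±(cosh θ, sinh θ)`. -/
lemma exists_cosh_sinh_of_sq_sub_sq_eq_one {a b : ℝ} (hab : a ^ 2 - b ^ 2 = 1) :
    ∃ θ ς : ℝ, (ς = 1 ∨ ς = -1) ∧ a = ς * Real.cosh θ ∧ b = ς * Real.sinh θ := by
  rcases le_total 0 a with ha | ha
  · refine ⟨Real.arsinh b, 1, Or.inl rfl, ?_, by simp⟩
    rw [Real.cosh_arsinh, show 1 + b ^ 2 = a ^ 2 by linarith, Real.sqrt_sq ha, one_mul]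
  · refine ⟨Real.arsinh (-b), -1, Or.inr rfl, ?_, by simp⟩
    rw [Real.cosh_arsinh, show 1 + (-b) ^ 2 = (-a) ^ 2 by linarith,
      Real.sqrt_sq (neg_nonneg.2 ha)]
    ring

/-- A double-number holomorphic function `f = g + jh` with `|f'|² ≡ 1`
on a connected domain has the form `f(t) = ±e^{jθ}·t + c`. -/
theorem stmt_17 (D : Set (ℝ × ℝ)) (hD : IsOpen D) (hconn : IsConnected D)
    (g h : ℝ × ℝ → ℝ) (hg : ContDiffOn ℝ 2 g D) (hh : ContDiffOn ℝ 2 h D)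
    (hCR1 : ∀ p ∈ D, pu h p = pv g p) (hCR2 : ∀ p ∈ D, pv h p = pu g p)
    (hnorm : ∀ p ∈ D, (pu g p) ^ 2 - (pv g p) ^ 2 = 1) :
    ∃ θ ς c₁ c₂ : ℝ, (ς = 1 ∨ ς = -1) ∧
      ∀ p ∈ D,
        g p = ς * (p.1 * Real.cosh θ + p.2 * Real.sinh θ) + c₁ ∧
        h p = ς * (p.1 * Real.sinh θ + p.2 * Real.cosh θ) + c₂ := by
  have hg1 : DifferentiableOn ℝ (fderiv ℝ g) D := fun p hp ↦
    (((hg.contDiffAt (hD.mem_nhds hp)).fderiv_right (m := 1) (by norm_num)).differentiableAt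
      (by norm_num)).differentiableWithinAt
  obtain ⟨L, hL⟩ := hD.exists_is_const_of_fderiv_eq_zero hconn.isPreconnected hg1
    fun p hp ↦ fderiv_fderiv_eq_zero_of_cauchyRiemann hD hg hh hCR1 hCR2 hnorm hp
  have hgu : ∀ p ∈ D, pu g p = L (1, 0) := fun p hp ↦ by rw [pu, hL p hp]
  have hgv : ∀ p ∈ D, pv g p = L (0, 1) := fun p hp ↦ by rw [pv, hL p hp]
  obtain ⟨q, hq⟩ := hconn.nonempty
  have hLn := hnorm q hq
  rw [hgu q hq, hgv q hq] at hLn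
  obtain ⟨θ, ς, hς, ha, hb⟩ := exists_cosh_sinh_of_sq_sub_sq_eq_one hLn
  obtain ⟨c₁, hc₁⟩ := exists_eq_affine_of_partials_eq hD hconn.isPreconnected
    (hg.differentiableOn (by norm_num)) hgu hgv
  obtain ⟨c₂, hc₂⟩ := exists_eq_affine_of_partials_eq hD hconn.isPreconnected
    (hh.differentiableOn (by norm_num)) (fun p hp ↦ (hCR1 p hp).trans (hgv p hp))
    (fun p hp ↦ (hCR2 p hp).trans (hgu p hp))
  refine ⟨θ, ς, c₁, c₂, hς, fun p hp ↦ ⟨?_, ?_⟩⟩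
  · rw [hc₁ p hp, ha, hb]
    ring
  · rw [hc₂ p hp, ha, hb]
    ring
end
end

section
/- Let x : D → ℝ⁴ be a smooth minimal time-like surface in isothermal coordinates with E < 0, let y : D → ℝ⁴ satisfy y_u = x_v and y_v = x_u, and for θ ∈ ℝ let x_θ := cosh(θ)·x + sinh(θ)·y be the associated family. Then at every point t ∈ D the Gauss curvature and normal curvature of x_θ (computed from x_θ by the defining formulas) coincide with those of x: K_θ(t) = K(t) and ϰ_θ(t) = ϰ(t). Hence the coordinate-identity map is a strong isometry (an isometry preserving the normal curvature) between x and every member x_θ of the associated family. -/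
noncomputable section

lemma ip_hyperbolic_sub (c s : ℝ) (h : c ^ 2 - s ^ 2 = 1) (a b : V4) :
    ip (c • b + s • a) (c • b + s • a) - ip (c • a + s • b) (c • a + s • b) =
      ip b b - ip a a := by
  simp only [ip, Pi.add_apply, Pi.smul_apply, smul_eq_mul]
  linear_combination (-(b 0 * b 0) + b 1 * b 1 - b 2 * b 2 + b 3 * b 3
    - (-(a 0 * a 0) + a 1 * a 1 - a 2 * a 2 + a 3 * a 3)) * h

lemma ip_hyperbolic_self (c s : ℝ) (h : c ^ 2 - s ^ 2 = 1) (a b : V4)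
    (hb : ip b b = -ip a a) (hab : ip a b = 0) :
    ip (c • a + s • b) (c • a + s • b) = ip a a := by
  simp only [ip, Pi.add_apply, Pi.smul_apply, smul_eq_mul] at *
  linear_combination (-(a 0 * a 0) + a 1 * a 1 - a 2 * a 2 + a 3 * a 3) * h
    + s ^ 2 * hb + 2 * c * s * hab

lemma det4_apply (v1 v2 v3 v4 : V4) :
    det4 v1 v2 v3 v4 =
      (v1 0 * v2 1 - v1 1 * v2 0) * (v3 2 * v4 3 - v3 3 * v4 2)
      - (v1 0 * v2 2 - v1 2 * v2 0) * (v3 1 * v4 3 - v3 3 * v4 1)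
      + (v1 0 * v2 3 - v1 3 * v2 0) * (v3 1 * v4 2 - v3 2 * v4 1)
      + (v1 1 * v2 2 - v1 2 * v2 1) * (v3 0 * v4 3 - v3 3 * v4 0)
      - (v1 1 * v2 3 - v1 3 * v2 1) * (v3 0 * v4 2 - v3 2 * v4 0)
      + (v1 2 * v2 3 - v1 3 * v2 2) * (v3 0 * v4 1 - v3 1 * v4 0) := by
  rw [det4, Matrix.det_transpose, Matrix.det_succ_row_zero]
  simp [Fin.sum_univ_succ, Matrix.det_fin_three, Fin.succAbove]
  ring

lemma minor_hyperbolic (c s : ℝ) (h : c ^ 2 - s ^ 2 = 1) (a b : V4) (i j : Fin 4) :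
    (c • a + s • b) i * (c • b + s • a) j - (c • a + s • b) j * (c • b + s • a) i =
      a i * b j - a j * b i := by
  simp only [Pi.add_apply, Pi.smul_apply, smul_eq_mul]
  linear_combination (a i * b j - a j * b i) * h

lemma det4_hyperbolic (c s : ℝ) (h : c ^ 2 - s ^ 2 = 1) (v1 v2 v3 v4 : V4) :
    det4 (c • v1 + s • v2) (c • v2 + s • v1) (c • v3 + s • v4) (c • v4 + s • v3) =
      det4 v1 v2 v3 v4 := by
  rw [det4_apply, det4_apply]
  simp only [minor_hyperbolic c s h]

lemma ip_lincomb_right (c s : ℝ) (w a b : V4) :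
    ip w (c • a + s • b) = c * ip w a + s * ip w b := by
  simp only [ip, Pi.add_apply, Pi.smul_apply, smul_eq_mul]
  ring

/-- The normal projection only depends on the tangent plane and on `E`. -/
lemma nproj_hyperbolic (c s : ℝ) (h : c ^ 2 - s ^ 2 = 1) (x z : ℝ × ℝ → V4) (p : ℝ × ℝ)
    (hE : Ef z p = Ef x p) (hu : pu z p = c • pu x p + s • pv x p)
    (hv : pv z p = c • pv x p + s • pu x p) (w : V4) : nproj z w p = nproj x w p := by
  simp only [nproj, hE, hu, hv, ip_lincomb_right]
  ext i
  simp only [Pi.add_apply, Pi.sub_apply, Pi.smul_apply, smul_eq_mul]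
  linear_combination (-(ip w (pu x p) / Ef x p * pu x p i)
    + ip w (pv x p) / Ef x p * pv x p i) * h

lemma nproj_lincomb (x : ℝ × ℝ → V4) (p : ℝ × ℝ) (c s : ℝ) (w w' : V4) :
    nproj x (c • w + s • w') p = c • nproj x w p + s • nproj x w' p := by
  ext i
  simp only [nproj, ip, Pi.add_apply, Pi.sub_apply, Pi.smul_apply, smul_eq_mul]
  ring

lemma fderiv_lincomb {f g : ℝ × ℝ → V4} {p : ℝ × ℝ} (hf : DifferentiableAt ℝ f p)
    (hg : DifferentiableAt ℝ g p) (c s : ℝ) (d : ℝ × ℝ) :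
    fderiv ℝ (fun q => c • f q + s • g q) p d = c • fderiv ℝ f p d + s • fderiv ℝ g p d := by
  have key : HasFDerivAt (fun q => c • f q + s • g q)
      (c • fderiv ℝ f p + s • fderiv ℝ g p) p :=
    (hf.hasFDerivAt.const_smul c).add (hg.hasFDerivAt.const_smul s)
  rw [key.fderiv]
  rfl

lemma pu_pv_comm {x : ℝ × ℝ → V4} {p : ℝ × ℝ} (hx : ContDiffAt ℝ 2 x p) :
    pu (pv x) p = pv (pu x) p := by
  have hd : DifferentiableAt ℝ (fderiv ℝ x) p :=
    (hx.fderiv_right (m := 1) (by norm_num)).differentiableAt (by norm_num)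
  have hsymm : IsSymmSndFDerivAt ℝ x p := hx.isSymmSndFDerivAt (by simp)
  have key : ∀ d e : ℝ × ℝ,
      fderiv ℝ (fun q => fderiv ℝ x q d) p e = fderiv ℝ (fderiv ℝ x) p e d := by
    intro d e
    rw [fderiv_clm_apply hd (differentiableAt_const d)]
    simp
  change fderiv ℝ (fun q => fderiv ℝ x q (0, 1)) p (1, 0) =
    fderiv ℝ (fun q => fderiv ℝ x q (1, 0)) p (0, 1)
  rw [key, key]
  exact hsymm (1, 0) (0, 1)

/-- The members of the associated family `x_θ = cosh θ · x + sinh θ · y`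
have the same Gauss curvature and the same normal curvature as `x` at every point;
together with `Ef x_θ = Ef x` this makes the coordinate-identity map a strong isometry
between `x` and `x_θ`. -/
theorem stmt_18 (D : Set (ℝ × ℝ)) (hD : IsOpen D) (x y : ℝ × ℝ → V4)
    (hx : ContDiffOn ℝ (⊤ : ℕ∞) x D) (hy : ContDiffOn ℝ (⊤ : ℕ∞) y D)
    (hiso : IsTimelikeIso D x) (hmin : IsMinimal D x)
    (hconj : ∀ p ∈ D, pu y p = pv x p ∧ pv y p = pu x p) (θ : ℝ) :
    ∀ p ∈ D,
      Ef (fun q => Real.cosh θ • x q + Real.sinh θ • y q) p = Ef x p ∧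
      GaussK (fun q => Real.cosh θ • x q + Real.sinh θ • y q) p = GaussK x p ∧
      NormK (fun q => Real.cosh θ • x q + Real.sinh θ • y q) p = NormK x p := by
  intro p hp
  set c := Real.cosh θ
  set s := Real.sinh θ
  have h : c ^ 2 - s ^ 2 = 1 := Real.cosh_sq_sub_sinh_sq θ
  set z : ℝ × ℝ → V4 := fun q => c • x q + s • y q
  have hxp : ContDiffAt ℝ 2 x p :=
    contDiffAt_infty.1 (hx.contDiffAt (hD.mem_nhds hp)) 2
  have hdx : ∀ q ∈ D, DifferentiableAt ℝ x q := fun q hq =>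
    (hx.contDiffAt (hD.mem_nhds hq)).differentiableAt (by simp)
  have hdy : ∀ q ∈ D, DifferentiableAt ℝ y q := fun q hq =>
    (hy.contDiffAt (hD.mem_nhds hq)).differentiableAt (by simp)
  have hu : ∀ q ∈ D, pu z q = c • pu x q + s • pv x q := fun q hq => by
    rw [← (hconj q hq).1]
    exact fderiv_lincomb (hdx q hq) (hdy q hq) c s (1, 0)
  have hv : pv z p = c • pv x p + s • pu x p := by
    rw [← (hconj p hp).2]
    exact fderiv_lincomb (hdx p hp) (hdy p hp) c s (0, 1)
  have hd : DifferentiableAt ℝ (fderiv ℝ x) p :=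
    (hxp.fderiv_right (m := 1) (by norm_num)).differentiableAt (by norm_num)
  have hdu : DifferentiableAt ℝ (pu x) p := hd.clm_apply (differentiableAt_const _)
  have hdv : DifferentiableAt ℝ (pv x) p := hd.clm_apply (differentiableAt_const _)
  have hfd : fderiv ℝ (pu z) p = fderiv ℝ (fun q => c • pu x q + s • pv x q) p :=
    Filter.EventuallyEq.fderiv_eq (Filter.eventually_of_mem (hD.mem_nhds hp) hu)
  have huu : pu (pu z) p = c • pu (pu x) p + s • pv (pu x) p := by
    rw [← pu_pv_comm hxp, pu, hfd]
    exact fderiv_lincomb hdu hdv c s (1, 0)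
  have huv : pv (pu z) p = c • pv (pu x) p + s • pu (pu x) p := by
    rw [sub_eq_zero.mp (hmin p hp), pv, hfd]
    exact fderiv_lincomb hdu hdv c s (0, 1)
  obtain ⟨-, hvv, huv0⟩ := hiso p hp
  have hE : Ef z p = Ef x p := by
    rw [Ef, hu p hp]
    exact ip_hyperbolic_self c s h _ _ hvv huv0
  have ha : sffA z p = c • sffA x p + s • sffB x p := by
    rw [sffA, nproj_hyperbolic c s h x z p hE (hu p hp) hv, huu, nproj_lincomb]
    rfl
  have hb : sffB z p = c • sffB x p + s • sffA x p := by
    rw [sffB, nproj_hyperbolic c s h x z p hE (hu p hp) hv, huv, nproj_lincomb]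
    rfl
  refine ⟨hE, ?_, ?_⟩
  · rw [GaussK, GaussK, hE, ha, hb, ip_hyperbolic_sub c s h]
  · rw [NormK, NormK, hE, ha, hb, hu p hp, hv, det4_hyperbolic c s h]
end
end
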